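/- Let α, ℓ > 0 and T be such that the Glauber dynamics for the modified SOS measure π_{Λ_L}^{0,f} satisfies P( η^ζ(T) ∈ G_ℓ ) ≥ α for every initial configuration ζ. Then there exists a constant c = c(α,β) such that the relaxation time satisfies T_rel(L) ≤ c·( exp(15β·ℓ·L) + L^{5β}·T² ). -/

import Mathlib

open scoped Classical
open Filter

noncomputable section

namespace SOSPaper

/-- Sites of the lattice `ℤ²`. -/
abbrev Site : Type := ℤ × ℤ

/-- Height configurations on `ℤ²`. -/
abbrev Config : Type := Site → ℤ

/-- Nearest-neighbour adjacency on `ℤ²`. -/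
def SiteAdj (x y : Site) : Prop := (x.1 - y.1).natAbs + (x.2 - y.2).natAbs = 1

/-- The four nearest neighbours of a site. -/
def nbrs (x : Site) : Finset Site :=
  {(x.1 + 1, x.2), (x.1 - 1, x.2), (x.1, x.2 + 1), (x.1, x.2 - 1)}

/-- The SOS Hamiltonian on `Λ` with boundary condition `ξ`:
`H_Λ^ξ(η) = (1/2) Σ_{x,y∈Λ adjacent} |η_x-η_y| + Σ_{x∈Λ, y∉Λ adjacent} |η_x-ξ_y|`. -/
def sosH (Λ : Finset Site) (ξ : Config) (η : Config) : ℝ :=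
  (1 / 2) * ∑ x ∈ Λ, ∑ y ∈ (nbrs x).filter (fun y => y ∈ Λ), ((|η x - η y| : ℤ) : ℝ)
    + ∑ x ∈ Λ, ∑ y ∈ (nbrs x).filter (fun y => y ∉ Λ), ((|η x - ξ y| : ℤ) : ℝ)

/-- Extension of `g : Λ → ℤ` by the boundary condition `ξ` off `Λ`. -/
def extendC (Λ : Finset Site) (ξ : Config) (g : {x // x ∈ Λ} → ℤ) : Config :=
  fun x => if h : x ∈ Λ then g ⟨x, h⟩ else ξ x

/-- Gibbs weight `exp(-β·H_Λ^ξ(η) + F(η))`, subject to the single-site constraint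
`η_x ∈ K` for all `x ∈ Λ` (floor/ceiling constraints); `F` is an extra external field
(`F = 0` for the plain SOS model). -/
def gWeight (β : ℝ) (Λ : Finset Site) (ξ : Config) (K : Set ℤ) (F : Config → ℝ)
    (η : Config) : ℝ :=
  if ∀ x ∈ Λ, η x ∈ K then Real.exp (-β * sosH Λ ξ η + F η) else 0

/-- The Gibbs probability of a set `A` of configurations: normalized sum of Gibbs
weights over all configurations agreeing with `ξ` off `Λ`. -/
def gProb (β : ℝ) (Λ : Finset Site) (ξ : Config) (K : Set ℤ) (F : Config → ℝ)
    (A : Set Config) : ℝ :=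
  (∑' g : {x // x ∈ Λ} → ℤ, Set.indicator A (gWeight β Λ ξ K F) (extendC Λ ξ g))
    / ∑' g : {x // x ∈ Λ} → ℤ, gWeight β Λ ξ K F (extendC Λ ξ g)

/-- The box `Λ_L = {1,…,L}²`. -/
def box (L : ℕ) : Finset Site := Finset.Icc ((1 : ℤ), (1 : ℤ)) ((L : ℤ), (L : ℤ))

/-- The equilibrium height `H(L) = ⌊log L / (4β)⌋`. -/
def eqHt (β : ℝ) (L : ℕ) : ℤ := ⌊Real.log L / (4 * β)⌋

/-- Heat-bath update probability at site `x` for new value `v`: the Gibbs conditional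
probability of the value `v` at `x` given the heights at all other sites. -/
def heatBath (β : ℝ) (Λ : Finset Site) (ξ : Config) (K : Set ℤ) (F : Config → ℝ)
    (η : Config) (x : Site) (v : ℤ) : ℝ :=
  gWeight β Λ ξ K F (Function.update η x v)
    / ∑' w : ℤ, gWeight β Λ ξ K F (Function.update η x w)

/-- One step of the Glauber (heat-bath) dynamics: pick a uniformly random site `x ∈ Λ`
and resample the height at `x` from the Gibbs conditional distribution. -/
def glauber (β : ℝ) (Λ : Finset Site) (ξ : Config) (K : Set ℤ) (F : Config → ℝ)
    (η σ : Config) : ℝ :=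
  ((Λ.card : ℝ))⁻¹ *
    ∑ x ∈ Λ, (if σ = Function.update η x (σ x) then heatBath β Λ ξ K F η x (σ x) else 0)

/-- `t`-step transition probabilities of a Markov kernel `P`. -/
def chainLaw (P : Config → Config → ℝ) : ℕ → Config → Config → ℝ
  | 0, η, σ => if σ = η then 1 else 0
  | (t + 1), η, σ => ∑' τ : Config, chainLaw P t η τ * P τ σ

/-- The law at time `t` of the chain started from `η`, evaluated on a set `A`. -/
def lawProb (P : Config → Config → ℝ) (t : ℕ) (η : Config) (A : Set Config) : ℝ :=
  ∑' σ : Config, Set.indicator A (chainLaw P t η) σ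

/-- Total variation distance between two set functions. -/
def tvDist (μ ν : Set Config → ℝ) : ℝ := ⨆ A : Set Config, |μ A - ν A|

/-- The state space of the dynamics: configurations agreeing with `ξ` off `Λ` and
obeying the constraint `K` on `Λ`. -/
def stateSpace (Λ : Finset Site) (ξ : Config) (K : Set ℤ) : Set Config :=
  {η | (∀ x ∈ Λ, η x ∈ K) ∧ ∀ x ∉ Λ, η x = ξ x}

/-- The mixing time of the Glauber dynamics: first time at which the total variation
distance to equilibrium is at most `1/(2e)`, uniformly in the initial configuration. -/
def mixingTime (β : ℝ) (Λ : Finset Site) (ξ : Config) (K : Set ℤ) (F : Config → ℝ) : ℕ :=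
  sInf {t : ℕ | 0 < t ∧ ∀ η ∈ stateSpace Λ ξ K,
    tvDist (lawProb (glauber β Λ ξ K F) t η) (gProb β Λ ξ K F) ≤ (2 * Real.exp 1)⁻¹}

/-- Expectation with respect to the Gibbs measure. -/
def gExp (β : ℝ) (Λ : Finset Site) (ξ : Config) (K : Set ℤ) (F : Config → ℝ)
    (f : Config → ℝ) : ℝ :=
  (∑' g : {x // x ∈ Λ} → ℤ, gWeight β Λ ξ K F (extendC Λ ξ g) * f (extendC Λ ξ g))
    / ∑' g : {x // x ∈ Λ} → ℤ, gWeight β Λ ξ K F (extendC Λ ξ g)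

/-- Action of a Markov kernel on a function. -/
def applyK (P : Config → Config → ℝ) (f : Config → ℝ) (η : Config) : ℝ :=
  ∑' σ : Config, P η σ * f σ

/-- The Dirichlet form `π(f(I−P)f)` of the Glauber dynamics. -/
def dirichlet (β : ℝ) (Λ : Finset Site) (ξ : Config) (K : Set ℤ) (F : Config → ℝ)
    (f : Config → ℝ) : ℝ :=
  gExp β Λ ξ K F (fun η => f η * (f η - applyK (glauber β Λ ξ K F) f η))

/-- The variance of `f` under the Gibbs measure. -/
def gVar (β : ℝ) (Λ : Finset Site) (ξ : Config) (K : Set ℤ) (F : Config → ℝ)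
    (f : Config → ℝ) : ℝ :=
  gExp β Λ ξ K F (fun η => (f η - gExp β Λ ξ K F f) ^ 2)

/-- The spectral gap of the Glauber dynamics, via the variational characterization
`gap = inf_{f non-constant} π(f(I−P)f)/Var_π(f)`. -/
def spectralGap (β : ℝ) (Λ : Finset Site) (ξ : Config) (K : Set ℤ) (F : Config → ℝ) : ℝ :=
  ⨅ f : {f : Config → ℝ //
      ¬ ∀ η ∈ stateSpace Λ ξ K, ∀ η' ∈ stateSpace Λ ξ K, f η = f η'},
    dirichlet β Λ ξ K F f.1 / gVar β Λ ξ K F f.1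

/-- The relaxation time: inverse spectral gap. -/
def relaxTime (β : ℝ) (Λ : Finset Site) (ξ : Config) (K : Set ℤ) (F : Config → ℝ) : ℝ :=
  (spectralGap β Λ ξ K F)⁻¹

/-- The trajectory determined by the initial configuration `η₀` and the sequence of
subsequent states `f`. -/
def trajOf (η₀ : Config) (f : ℕ → Config) : ℕ → Config
  | 0 => η₀
  | (t + 1) => f t

/-- The steps function obtained from finitely many steps, extended arbitrarily. -/
def extSteps (N : ℕ) (η₀ : Config) (f : Fin N → Config) : ℕ → Config :=
  fun t => if h : t < N then f ⟨t, h⟩ else η₀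

/-- The probability that the trajectory of the chain started at `η₀` satisfies the
event `E` (an event depending only on the first `N` steps). -/
def pathProb (P : Config → Config → ℝ) (η₀ : Config) (N : ℕ)
    (E : (ℕ → Config) → Prop) : ℝ :=
  ∑' f : Fin N → Config,
    if E (trajOf η₀ (extSteps N η₀ f)) then
      ∏ t ∈ Finset.range N,
        P (trajOf η₀ (extSteps N η₀ f) t) (trajOf η₀ (extSteps N η₀ f) (t + 1))
    else 0

/-- The ceiling height `n⁺ = ⌊log L⌋`. -/
def ceilN (L : ℕ) : ℤ := ⌊Real.log L⌋

/-- The external field `f(η) = (1/L) Σ_{y∈Λ} Σ_{j=1}^{n⁺−H(L)} e^{−βj} 1_{η_y ≤ H(L)+j}`. -/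
def fieldF (β : ℝ) (L : ℕ) (Λ : Finset Site) (η : Config) : ℝ :=
  (L : ℝ)⁻¹ * ∑ y ∈ Λ, ∑ j ∈ Finset.Icc (1 : ℤ) (ceilN L - eqHt β L),
    Real.exp (-β * (j : ℝ)) * (if η y ≤ eqHt β L + j then 1 else 0)

/-- One step of the Glauber dynamics for the modified SOS measure `π_{Λ_L}^{0,f}`
(zero boundary conditions, floor at `0`, ceiling at `n⁺ = ⌊log L⌋`, field `f`). -/
def glauberMod (β : ℝ) (L : ℕ) : Config → Config → ℝ :=
  glauber β (box L) 0 (Set.Icc 0 (ceilN L)) (fieldF β L (box L))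

/-- Mixing time of the Glauber dynamics for the modified SOS measure `π_{Λ_L}^{0,f}`. -/
def TmixMod (β : ℝ) (L : ℕ) : ℕ :=
  mixingTime β (box L) 0 (Set.Icc 0 (ceilN L)) (fieldF β L (box L))

/-- `k`-fold iterated logarithm. -/
def iterLog : ℕ → ℝ → ℝ
  | 0, x => x
  | (k + 1), x => Real.log (iterLog k x)

/-- `log^{(k)}(x) = max(1, log log … log x)` (`k` iterations). -/
def logK (k : ℕ) (x : ℝ) : ℝ := max 1 (iterLog k x)

/-- The inductive statement `F_{k,a,A}`: for every `L`, the mixing time of the Glauber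
dynamics for the modified SOS measure satisfies `T_mix(L) ≤ L^a exp(A·L·log^{(k)} L)`. -/
def Fstmt (β a A : ℝ) (k : ℕ) : Prop :=
  ∀ L : ℕ, (TmixMod β L : ℝ) ≤ (L : ℝ) ^ a * Real.exp (A * L * logK k L)

/-- The diagonal line `R_i = {x ∈ Λ_L : x₂ = x₁ + L − i}`. -/
def diagR (L : ℕ) (i : ℕ) : Finset Site :=
  (box L).filter (fun x => x.2 = x.1 + (L : ℤ) - (i : ℤ))

/-- `G⁻_ℓ`: on every diagonal, `Σ_x max(H − η_x, 0) ≤ Lℓ`. -/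
def Gminus (β : ℝ) (L : ℕ) (ℓ : ℝ) : Set Config :=
  {η | ∀ i ∈ Finset.Icc 1 (2 * L - 1),
    ((∑ x ∈ diagR L i, max (eqHt β L - η x) 0 : ℤ) : ℝ) ≤ (L : ℝ) * ℓ}

/-- `G⁺_ℓ`: on every diagonal, `Σ_x max(η_x − H, 0) ≤ Lℓ`. -/
def Gplus (β : ℝ) (L : ℕ) (ℓ : ℝ) : Set Config :=
  {η | ∀ i ∈ Finset.Icc 1 (2 * L - 1),
    ((∑ x ∈ diagR L i, max (η x - eqHt β L) 0 : ℤ) : ℝ) ≤ (L : ℝ) * ℓ}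

/-- `G_ℓ`: on every diagonal, `Σ_x |η_x − H| ≤ Lℓ`. -/
def Gabs (β : ℝ) (L : ℕ) (ℓ : ℝ) : Set Config :=
  {η | ∀ i ∈ Finset.Icc 1 (2 * L - 1),
    ((∑ x ∈ diagR L i, |η x - eqHt β L| : ℤ) : ℝ) ≤ (L : ℝ) * ℓ}

section AbstractChain


/-! abstract chain -/

structure ChainHyp (S : Finset Config) (w : Config → ℝ) (p : Config → Config → ℝ) : Prop where
  hw : ∀ η ∈ S, 0 < w η
  hp0 : ∀ η ∈ S, ∀ σ, 0 ≤ p η σ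
  hpS : ∀ η ∈ S, ∀ σ, σ ∉ S → p η σ = 0
  hp1 : ∀ η ∈ S, ∑ σ ∈ S, p η σ = 1
  hst : ∀ σ ∈ S, ∑ η ∈ S, w η * p η σ = w σ

variable {S : Finset Config} {w : Config → ℝ} {p : Config → Config → ℝ}

lemma chain_supp (h : ChainHyp S w p) (t : ℕ) : ∀ η ∈ S, ∀ σ, σ ∉ S → chainLaw p t η σ = 0 := by
  induction t with
  | zero =>
    intro η hη σ hσ
    simp only [chainLaw]
    rw [if_neg]
    rintro rfl
    exact hσ hη
  | succ t ih =>
    intro η hη σ hσ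
    simp only [chainLaw]
    rw [tsum_eq_sum (s := S) (fun τ hτ => by rw [ih η hη τ hτ, zero_mul])]
    exact Finset.sum_eq_zero fun τ hτ => by rw [h.hpS τ hτ σ hσ, mul_zero]

lemma chain_succ (h : ChainHyp S w p) (t : ℕ) (η : Config) (hη : η ∈ S) (σ : Config) :
    chainLaw p (t + 1) η σ = ∑ τ ∈ S, chainLaw p t η τ * p τ σ := by
  simp only [chainLaw]
  exact tsum_eq_sum (s := S) (fun τ hτ => by rw [chain_supp h t η hη τ hτ, zero_mul])

lemma chain_nonneg (h : ChainHyp S w p) (t : ℕ) : ∀ η ∈ S, ∀ σ, 0 ≤ chainLaw p t η σ := by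
  induction t with
  | zero =>
    intro η hη σ
    simp only [chainLaw]
    split_ifs <;> norm_num
  | succ t ih =>
    intro η hη σ
    rw [chain_succ h t η hη]
    exact Finset.sum_nonneg fun τ hτ => mul_nonneg (ih η hη τ) (h.hp0 τ hτ σ)

lemma chain_one (h : ChainHyp S w p) (t : ℕ) : ∀ η ∈ S, ∑ σ ∈ S, chainLaw p t η σ = 1 := by
  induction t with
  | zero =>
    intro η hη
    simp only [chainLaw]
    rw [Finset.sum_ite_eq' S η]
    simp [hη]
  | succ t ih =>
    intro η hη
    simp_rw [chain_succ h t η hη]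
    rw [Finset.sum_comm, ← ih η hη]
    refine Finset.sum_congr rfl fun τ hτ => ?_
    rw [← Finset.mul_sum, h.hp1 τ hτ, mul_one]

lemma chain_stat (h : ChainHyp S w p) (t : ℕ) :
    ∀ σ ∈ S, ∑ η ∈ S, w η * chainLaw p t η σ = w σ := by
  induction t with
  | zero =>
    intro σ hσ
    simp only [chainLaw, mul_ite, mul_one, mul_zero]
    rw [Finset.sum_ite_eq S σ]
    simp [hσ]
  | succ t ih =>
    intro σ hσ
    rw [← h.hst σ hσ]
    calc ∑ η ∈ S, w η * chainLaw p (t + 1) η σ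
        = ∑ η ∈ S, ∑ τ ∈ S, w η * chainLaw p t η τ * p τ σ := by
          refine Finset.sum_congr rfl fun η hη => ?_
          rw [chain_succ h t η hη, Finset.mul_sum]
          exact Finset.sum_congr rfl fun τ _ => by ring
      _ = ∑ τ ∈ S, ∑ η ∈ S, w η * chainLaw p t η τ * p τ σ := Finset.sum_comm
      _ = ∑ τ ∈ S, w τ * p τ σ := by
          refine Finset.sum_congr rfl fun τ hτ => ?_
          rw [← Finset.sum_mul, ih τ hτ]

/-- two-point energy at time t -/
def enA (S : Finset Config) (w : Config → ℝ) (q : Config → Config → ℝ) (f : Config → ℝ) : ℝ :=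
  ∑ η ∈ S, ∑ σ ∈ S, w η * q η σ * (f η - f σ) ^ 2

lemma enA_le (h : ChainHyp S w p) (f : Config → ℝ) (t : ℕ) :
    enA S w (chainLaw p t) f ≤ (t : ℝ) ^ 2 * enA S w p f := by
  induction t with
  | zero =>
    simp only [enA, chainLaw]
    apply le_of_eq
    simp only [CharP.cast_eq_zero, ne_eq, OfNat.ofNat_ne_zero, not_false_eq_true, zero_pow, zero_mul]
    refine Finset.sum_eq_zero fun η _ => Finset.sum_eq_zero fun σ _ => ?_
    split_ifs with hh
    · rw [hh]; simp
    · simp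
  | succ t ih =>
    rcases Nat.eq_zero_or_pos t with rfl | ht
    · have : ∀ η ∈ S, ∀ σ, chainLaw p (0 + 1) η σ = p η σ := by
        intro η hη σ
        rw [chain_succ h 0 η hη]
        simp only [chainLaw, ite_mul, one_mul, zero_mul]
        rw [Finset.sum_ite_eq' S η]; simp [hη]
      apply le_of_eq
      simp only [enA, Nat.cast_one, Nat.zero_add, one_pow, one_mul]
      refine Finset.sum_congr rfl fun η hη => Finset.sum_congr rfl fun σ _ => ?_
      rw [← this η hη σ]
    · have ht' : (0 : ℝ) < t := by exact_mod_cast ht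
      have key : enA S w (chainLaw p (t + 1)) f ≤
          (1 + (t : ℝ)⁻¹) * enA S w (chainLaw p t) f + (1 + t) * enA S w p f := by
        calc enA S w (chainLaw p (t + 1)) f
            = ∑ η ∈ S, ∑ σ ∈ S, ∑ τ ∈ S, w η * chainLaw p t η τ * p τ σ * (f η - f σ) ^ 2 := by
              refine Finset.sum_congr rfl fun η hη => Finset.sum_congr rfl fun σ _ => ?_
              rw [chain_succ h t η hη, Finset.mul_sum, Finset.sum_mul]
              exact Finset.sum_congr rfl fun τ _ => by ring
          _ ≤ ∑ η ∈ S, ∑ σ ∈ S, ∑ τ ∈ S,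
                ((1 + (t : ℝ)⁻¹) * (w η * chainLaw p t η τ * (f η - f τ) ^ 2 * p τ σ)
                  + (1 + t) * (w η * chainLaw p t η τ * (p τ σ * (f τ - f σ) ^ 2))) := by
              refine Finset.sum_le_sum fun η hη => Finset.sum_le_sum fun σ _ =>
                Finset.sum_le_sum fun τ hτ => ?_
              have h1 : 0 ≤ w η * chainLaw p t η τ * p τ σ :=
                mul_nonneg (mul_nonneg (h.hw η hη).le (chain_nonneg h t η hη τ)) (h.hp0 τ hτ σ)
              have h2 : (f η - f σ) ^ 2 ≤
                  (1 + (t : ℝ)⁻¹) * (f η - f τ) ^ 2 + (1 + t) * (f τ - f σ) ^ 2 := by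
                have e : (1 + (t : ℝ)⁻¹) * (f η - f τ) ^ 2 + (1 + t) * (f τ - f σ) ^ 2
                    - (f η - f σ) ^ 2 = (t : ℝ)⁻¹ * ((f η - f τ) - t * (f τ - f σ)) ^ 2 := by
                  field_simp; ring
                have : 0 ≤ (t : ℝ)⁻¹ * ((f η - f τ) - t * (f τ - f σ)) ^ 2 := by positivity
                linarith
              have := mul_le_mul_of_nonneg_left h2 h1
              linarith
          _ = (1 + (t : ℝ)⁻¹) * enA S w (chainLaw p t) f + (1 + t) * enA S w p f := by
              simp_rw [Finset.sum_add_distrib, ← Finset.mul_sum]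
              congr 2
              · simp only [enA]
                refine Finset.sum_congr rfl fun η _ => ?_
                rw [Finset.sum_comm]
                refine Finset.sum_congr rfl fun τ hτ => ?_
                rw [← Finset.mul_sum, h.hp1 τ hτ, mul_one]
              · simp only [enA]
                calc ∑ η ∈ S, ∑ σ ∈ S, ∑ τ ∈ S,
                      w η * chainLaw p t η τ * (p τ σ * (f τ - f σ) ^ 2)
                    = ∑ σ ∈ S, ∑ τ ∈ S, ∑ η ∈ S,
                      w η * chainLaw p t η τ * (p τ σ * (f τ - f σ) ^ 2) := by
                      rw [Finset.sum_comm]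
                      exact Finset.sum_congr rfl fun σ _ => Finset.sum_comm
                  _ = ∑ σ ∈ S, ∑ τ ∈ S, w τ * p τ σ * (f τ - f σ) ^ 2 := by
                      refine Finset.sum_congr rfl fun σ _ => Finset.sum_congr rfl fun τ hτ => ?_
                      rw [← Finset.sum_mul, chain_stat h t τ hτ]; ring
                  _ = _ := Finset.sum_comm
      have h3 := mul_le_mul_of_nonneg_left ih (show (0 : ℝ) ≤ 1 + (t : ℝ)⁻¹ by positivity)
      have e : (1 + (t : ℝ)⁻¹) * ((t : ℝ) ^ 2 * enA S w p f) + (1 + t) * enA S w p f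
          = ((t + 1 : ℕ) : ℝ) ^ 2 * enA S w p f := by
        push_cast; field_simp; ring
      linarith

lemma enA_eq (h : ChainHyp S w p) (f : Config → ℝ) :
    enA S w p f = 2 * ∑ η ∈ S, w η * (f η * (f η - ∑ σ ∈ S, p η σ * f σ)) := by
  have e1 : ∑ η ∈ S, ∑ σ ∈ S, w η * p η σ * (f η) ^ 2 = ∑ η ∈ S, w η * f η ^ 2 := by
    refine Finset.sum_congr rfl fun η hη => ?_
    rw [← Finset.sum_mul, ← Finset.mul_sum, h.hp1 η hη, mul_one]
  have e2 : ∑ η ∈ S, ∑ σ ∈ S, w η * p η σ * (f σ) ^ 2 = ∑ η ∈ S, w η * f η ^ 2 := by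
    rw [Finset.sum_comm]
    refine Finset.sum_congr rfl fun σ hσ => ?_
    rw [← Finset.sum_mul, h.hst σ hσ]
  have e3 : ∑ η ∈ S, w η * (f η * (f η - ∑ σ ∈ S, p η σ * f σ))
      = ∑ η ∈ S, w η * f η ^ 2 - ∑ η ∈ S, ∑ σ ∈ S, w η * p η σ * (f η * f σ) := by
    rw [← Finset.sum_sub_distrib]
    refine Finset.sum_congr rfl fun η _ => ?_
    rw [mul_sub, mul_sub, Finset.mul_sum, Finset.mul_sum]
    congr 1
    · ring
    · exact Finset.sum_congr rfl fun σ _ => by ring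
  rw [e3]
  have e4 : enA S w p f = ∑ η ∈ S, ∑ σ ∈ S, w η * p η σ * (f η) ^ 2
      + ∑ η ∈ S, ∑ σ ∈ S, w η * p η σ * (f σ) ^ 2
      - 2 * ∑ η ∈ S, ∑ σ ∈ S, w η * p η σ * (f η * f σ) := by
    simp_rw [enA, Finset.mul_sum, ← Finset.sum_add_distrib, ← Finset.sum_sub_distrib]
    exact Finset.sum_congr rfl fun η _ => Finset.sum_congr rfl fun σ _ => by ring
  rw [e4, e1, e2]; ring

lemma lawProb_eq (h : ChainHyp S w p) (t : ℕ) (η : Config) (hη : η ∈ S) (A : Set Config) :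
    lawProb p t η A = ∑ σ ∈ S.filter (fun σ => σ ∈ A), chainLaw p t η σ := by
  unfold lawProb
  rw [tsum_eq_sum (s := S), Finset.sum_filter]
  · exact Finset.sum_congr rfl fun σ _ => by simp [Set.indicator_apply]
  · intro σ hσ
    rw [Set.indicator_apply, chain_supp h t η hη σ hσ, ite_self]

lemma good_mass (h : ChainHyp S w p) (t : ℕ) (A : Set Config) (α : ℝ)
    (hα : ∀ η ∈ S, α ≤ lawProb p t η A) :
    α * ∑ η ∈ S, w η ≤ ∑ η ∈ S.filter (fun σ => σ ∈ A), w η := by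
  calc α * ∑ η ∈ S, w η = ∑ η ∈ S, w η * α := by rw [Finset.mul_sum]; simp_rw [mul_comm]
    _ ≤ ∑ η ∈ S, w η * ∑ σ ∈ S.filter (fun σ => σ ∈ A), chainLaw p t η σ := by
      refine Finset.sum_le_sum fun η hη => mul_le_mul_of_nonneg_left ?_ (h.hw η hη).le
      rw [← lawProb_eq h t η hη]; exact hα η hη
    _ = ∑ σ ∈ S.filter (fun σ => σ ∈ A), ∑ η ∈ S, w η * chainLaw p t η σ := by
      simp_rw [Finset.mul_sum]; exact Finset.sum_comm
    _ = _ := Finset.sum_congr rfl fun σ hσ => chain_stat h t σ (Finset.mem_filter.1 hσ).1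

lemma step_good (h : ChainHyp S w p) (t : ℕ) (A : Set Config) (α : ℝ)
    (hα : ∀ η ∈ S, α ≤ lawProb p t η A) (f : Config → ℝ) (c : ℝ) :
    α * ∑ η ∈ S, w η * (f η - c) ^ 2 ≤ 2 * enA S w (chainLaw p t) f
      + 2 * ∑ σ ∈ S.filter (fun σ => σ ∈ A), w σ * (f σ - c) ^ 2 := by
  set G := S.filter (fun σ => σ ∈ A) with hG
  have hGS : G ⊆ S := Finset.filter_subset _ _
  calc α * ∑ η ∈ S, w η * (f η - c) ^ 2 = ∑ η ∈ S, (w η * (f η - c) ^ 2) * α := by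
        rw [Finset.mul_sum]; simp_rw [mul_comm]
    _ ≤ ∑ η ∈ S, (w η * (f η - c) ^ 2) * ∑ σ ∈ G, chainLaw p t η σ := by
      refine Finset.sum_le_sum fun η hη => mul_le_mul_of_nonneg_left ?_
        (mul_nonneg (h.hw η hη).le (sq_nonneg _))
      rw [← lawProb_eq h t η hη]; exact hα η hη
    _ = ∑ η ∈ S, ∑ σ ∈ G, (w η * chainLaw p t η σ) * (f η - c) ^ 2 := by
      refine Finset.sum_congr rfl fun η _ => ?_
      rw [Finset.mul_sum]
      exact Finset.sum_congr rfl fun σ _ => by ring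
    _ ≤ ∑ η ∈ S, ∑ σ ∈ G, (2 * (w η * chainLaw p t η σ * (f η - f σ) ^ 2)
          + 2 * (w η * chainLaw p t η σ * (f σ - c) ^ 2)) := by
      refine Finset.sum_le_sum fun η hη => Finset.sum_le_sum fun σ _ => ?_
      have h1 := mul_nonneg (h.hw η hη).le (chain_nonneg h t η hη σ)
      nlinarith [mul_nonneg h1 (sq_nonneg ((f η - f σ) - (f σ - c)))]
    _ = 2 * ∑ η ∈ S, ∑ σ ∈ G, w η * chainLaw p t η σ * (f η - f σ) ^ 2
          + 2 * ∑ σ ∈ G, ∑ η ∈ S, w η * chainLaw p t η σ * (f σ - c) ^ 2 := by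
      simp_rw [Finset.sum_add_distrib, ← Finset.mul_sum]
      congr 2
      exact Finset.sum_comm
    _ ≤ _ := by
      apply add_le_add
      · refine mul_le_mul_of_nonneg_left ?_ (by norm_num)
        refine Finset.sum_le_sum fun η hη => Finset.sum_le_sum_of_subset_of_nonneg hGS ?_
        intro σ _ _
        exact mul_nonneg (mul_nonneg (h.hw η hη).le (chain_nonneg h t η hη σ)) (sq_nonneg _)
      · refine le_of_eq ?_
        congr 1
        refine Finset.sum_congr rfl fun σ hσ => ?_
        rw [← Finset.sum_mul, chain_stat h t σ (hGS hσ)]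

lemma two_point (h : ChainHyp S w p) (t : ℕ) (A : Set Config) (α : ℝ) (hα0 : 0 < α)
    (hα : ∀ η ∈ S, α ≤ lawProb p t η A) (f : Config → ℝ) :
    α ^ 2 * ∑ y ∈ S, w y * ∑ x ∈ S, w x * (f x - f y) ^ 2 ≤
      (2 * α + 4) * (∑ x ∈ S, w x) * enA S w (chainLaw p t) f
      + 4 * ∑ z ∈ S.filter (fun σ => σ ∈ A), w z *
          ∑ u ∈ S.filter (fun σ => σ ∈ A), w u * (f u - f z) ^ 2 := by
  set G := S.filter (fun σ => σ ∈ A) with hG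
  have hGS : G ⊆ S := Finset.filter_subset _ _
  set E := enA S w (chainLaw p t) f with hE
  have hE0 : 0 ≤ E := Finset.sum_nonneg fun η hη => Finset.sum_nonneg fun σ _ =>
    mul_nonneg (mul_nonneg (h.hw η hη).le (chain_nonneg h t η hη σ)) (sq_nonneg _)
  have s1 : α * ∑ y ∈ S, w y * ∑ x ∈ S, w x * (f x - f y) ^ 2 ≤
      ∑ y ∈ S, w y * (2 * E + 2 * ∑ z ∈ G, w z * (f z - f y) ^ 2) := by
    rw [Finset.mul_sum]
    refine Finset.sum_le_sum fun y hy => ?_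
    have := mul_le_mul_of_nonneg_left (step_good h t A α hα f (f y)) (h.hw y hy).le
    linarith
  have s2 : ∑ y ∈ S, w y * (2 * E + 2 * ∑ z ∈ G, w z * (f z - f y) ^ 2)
      = 2 * (∑ x ∈ S, w x) * E + 2 * ∑ z ∈ G, w z * ∑ y ∈ S, w y * (f y - f z) ^ 2 := by
    simp_rw [mul_add, Finset.sum_add_distrib]
    congr 1
    · rw [← Finset.sum_mul]; ring
    · simp_rw [Finset.mul_sum]
      rw [Finset.sum_comm]
      exact Finset.sum_congr rfl fun z _ => Finset.sum_congr rfl fun y _ => by ring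
  have s3 : α * ∑ z ∈ G, w z * ∑ y ∈ S, w y * (f y - f z) ^ 2 ≤
      ∑ z ∈ G, w z * (2 * E + 2 * ∑ u ∈ G, w u * (f u - f z) ^ 2) := by
    rw [Finset.mul_sum]
    refine Finset.sum_le_sum fun y hy => ?_
    have := mul_le_mul_of_nonneg_left (step_good h t A α hα f (f y)) (h.hw y (hGS hy)).le
    linarith
  have s4 : ∑ z ∈ G, w z * (2 * E + 2 * ∑ u ∈ G, w u * (f u - f z) ^ 2)
      = 2 * (∑ x ∈ G, w x) * E + 2 * ∑ z ∈ G, w z * ∑ y ∈ G, w y * (f y - f z) ^ 2 := by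
    simp_rw [mul_add, Finset.sum_add_distrib]
    congr 1
    · rw [← Finset.sum_mul]; ring
    · rw [Finset.mul_sum]
      exact Finset.sum_congr rfl fun z _ => by ring
  have s5 : ∑ x ∈ G, w x ≤ ∑ x ∈ S, w x :=
    Finset.sum_le_sum_of_subset_of_nonneg hGS fun x hx _ => (h.hw x hx).le
  have s6 := mul_le_mul_of_nonneg_right s5 hE0
  have s7 := mul_le_mul_of_nonneg_left s1 hα0.le
  rw [s2] at s7
  rw [s4] at s3
  nlinarith


end AbstractChain

section HeatBath

def Om (Λ : Finset Site) (ξ : Config) (n : ℤ) : Finset Config :=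
  Finset.image (extendC Λ ξ) (Fintype.piFinset fun _ => Finset.Icc 0 n)

lemma mem_Om (Λ : Finset Site) (ξ : Config) (n : ℤ) (η : Config) :
    η ∈ Om Λ ξ n ↔ η ∈ stateSpace Λ ξ (Set.Icc 0 n) := by
  unfold Om stateSpace
  rw [Finset.mem_image]
  constructor
  · rintro ⟨g, hg, rfl⟩
    rw [Fintype.mem_piFinset] at hg
    refine ⟨fun x hx => ?_, fun x hx => ?_⟩
    · have := hg ⟨x, hx⟩
      rw [Finset.mem_Icc] at this
      simp only [extendC, hx, dif_pos, Set.mem_Icc]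
      exact this
    · simp [extendC, hx]
  · rintro ⟨h1, h2⟩
    refine ⟨fun x => η x.1, ?_, ?_⟩
    · rw [Fintype.mem_piFinset]
      intro x
      rw [Finset.mem_Icc]
      exact h1 x.1 x.2
    · funext x
      by_cases hx : x ∈ Λ
      · simp [extendC, hx]
      · simp [extendC, hx, h2 x hx]

lemma extendC_inj (Λ : Finset Site) (ξ : Config) : Function.Injective (extendC Λ ξ) := by
  intro g g' h
  funext x
  have := congrFun h x.1
  simpa [extendC, x.2] using this

lemma tsum_extend (Λ : Finset Site) (ξ : Config) (n : ℤ) (h : Config → ℝ)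
    (hz : ∀ η, (¬ ∀ x ∈ Λ, η x ∈ Set.Icc 0 n) → h η = 0) :
    ∑' g : {x // x ∈ Λ} → ℤ, h (extendC Λ ξ g) = ∑ η ∈ Om Λ ξ n, h η := by
  unfold Om
  rw [Finset.sum_image (fun a _ b _ hab => extendC_inj Λ ξ hab)]
  apply tsum_eq_sum
  intro g hg
  apply hz
  intro hh
  apply hg
  rw [Fintype.mem_piFinset]
  intro x
  have := hh x.1 x.2
  rw [Finset.mem_Icc]
  simpa [extendC, x.2] using this

variable (β : ℝ) (Λ : Finset Site) (ξ : Config) (n : ℤ) (F : Config → ℝ)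

lemma gWeight_zero (η : Config) (h : ¬ ∀ x ∈ Λ, η x ∈ Set.Icc 0 n) :
    gWeight β Λ ξ (Set.Icc 0 n) F η = 0 := by
  unfold gWeight; rw [if_neg h]

lemma gWeight_Om (η : Config) (h : η ∈ Om Λ ξ n) :
    gWeight β Λ ξ (Set.Icc 0 n) F η = Real.exp (-β * sosH Λ ξ η + F η) := by
  unfold gWeight; rw [if_pos ((mem_Om Λ ξ n η).1 h).1]

lemma gWeight_pos (η : Config) (h : η ∈ Om Λ ξ n) :
    0 < gWeight β Λ ξ (Set.Icc 0 n) F η := by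
  rw [gWeight_Om β Λ ξ n F η h]; exact Real.exp_pos _

lemma gWeight_nonneg (η : Config) :
    0 ≤ gWeight β Λ ξ (Set.Icc 0 n) F η := by
  unfold gWeight; split_ifs
  · exact (Real.exp_pos _).le
  · exact le_rfl

lemma update_mem_Om (η : Config) (h : η ∈ Om Λ ξ n) (x : Site) (hx : x ∈ Λ) (v : ℤ)
    (hv : v ∈ Finset.Icc 0 n) : Function.update η x v ∈ Om Λ ξ n := by
  rw [mem_Om] at h ⊢
  rw [Finset.mem_Icc] at hv
  refine ⟨fun y hy => ?_, fun y hy => ?_⟩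
  · by_cases hyx : y = x
    · subst hyx; simpa using hv
    · rw [Function.update_of_ne hyx]; exact h.1 y hy
  · have hyx : y ≠ x := fun e => hy (e ▸ hx)
    rw [Function.update_of_ne hyx]; exact h.2 y hy

def Zx (η : Config) (x : Site) : ℝ :=
  ∑ v ∈ Finset.Icc 0 n, gWeight β Λ ξ (Set.Icc 0 n) F (Function.update η x v)

lemma heatBath_eq (η : Config) (x : Site) (hx : x ∈ Λ) (v : ℤ) :
    heatBath β Λ ξ (Set.Icc 0 n) F η x v =
      gWeight β Λ ξ (Set.Icc 0 n) F (Function.update η x v) / Zx β Λ ξ n F η x := by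
  unfold heatBath Zx
  congr 1
  apply tsum_eq_sum
  intro w hw
  apply gWeight_zero
  intro hh
  have := hh x hx
  rw [Function.update_self] at this
  exact hw (Finset.mem_Icc.2 this)

lemma Zx_pos (η : Config) (h : η ∈ Om Λ ξ n) (x : Site) (hx : x ∈ Λ) :
    0 < Zx β Λ ξ n F η x := by
  unfold Zx
  have hm : η x ∈ Finset.Icc 0 n := Finset.mem_Icc.2 (((mem_Om Λ ξ n η).1 h).1 x hx)
  exact Finset.sum_pos (fun v hv => gWeight_pos β Λ ξ n F _ (update_mem_Om Λ ξ n η h x hx v hv))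
    ⟨_, hm⟩

lemma heatBath_nonneg (η : Config) (x : Site) (hx : x ∈ Λ) (v : ℤ) :
    0 ≤ heatBath β Λ ξ (Set.Icc 0 n) F η x v := by
  rw [heatBath_eq β Λ ξ n F η x hx]
  exact div_nonneg (gWeight_nonneg _ _ _ _ _ _)
    (Finset.sum_nonneg fun v _ => gWeight_nonneg _ _ _ _ _ _)

lemma heatBath_sum (η : Config) (h : η ∈ Om Λ ξ n) (x : Site) (hx : x ∈ Λ) :
    ∑ v ∈ Finset.Icc 0 n, heatBath β Λ ξ (Set.Icc 0 n) F η x v = 1 := by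
  simp_rw [heatBath_eq β Λ ξ n F η x hx]
  rw [← Finset.sum_div]
  exact div_self (Zx_pos β Λ ξ n F η h x hx).ne'

lemma heatBath_update (η : Config) (x : Site) (u v : ℤ) :
    heatBath β Λ ξ (Set.Icc 0 n) F (Function.update η x u) x v
      = heatBath β Λ ξ (Set.Icc 0 n) F η x v := by
  unfold heatBath
  simp only [Function.update_idem]

lemma glauber_sum (η : Config) (h : η ∈ Om Λ ξ n) (g : Config → ℝ) :
    ∑ σ ∈ Om Λ ξ n, glauber β Λ ξ (Set.Icc 0 n) F η σ * g σ =
      (Λ.card : ℝ)⁻¹ * ∑ x ∈ Λ, ∑ v ∈ Finset.Icc 0 n,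
        heatBath β Λ ξ (Set.Icc 0 n) F η x v * g (Function.update η x v) := by
  unfold glauber
  simp_rw [mul_assoc]
  rw [← Finset.mul_sum]
  congr 1
  simp_rw [Finset.sum_mul]
  rw [Finset.sum_comm]
  refine Finset.sum_congr rfl fun x hx => ?_
  simp_rw [ite_mul, zero_mul]
  rw [← Finset.sum_filter]
  symm
  refine Finset.sum_bij (fun v _ => Function.update η x v) ?_ ?_ ?_ ?_
  · intro v hv
    rw [Finset.mem_filter]
    refine ⟨update_mem_Om Λ ξ n η h x hx v hv, ?_⟩
    rw [Function.update_self]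
  · intro a _ b _ hab
    have := congrFun hab x
    simpa using this
  · intro σ hσ
    rw [Finset.mem_filter] at hσ
    exact ⟨σ x, Finset.mem_Icc.2 (((mem_Om Λ ξ n σ).1 hσ.1).1 x hx), hσ.2.symm⟩
  · intro v _
    rw [Function.update_self]

lemma glauber_symm (η σ : Config) (h : η ∈ Om Λ ξ n) (h' : σ ∈ Om Λ ξ n) :
    gWeight β Λ ξ (Set.Icc 0 n) F η * glauber β Λ ξ (Set.Icc 0 n) F η σ
      = gWeight β Λ ξ (Set.Icc 0 n) F σ * glauber β Λ ξ (Set.Icc 0 n) F σ η := by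
  unfold glauber
  rw [mul_left_comm, mul_left_comm (gWeight β Λ ξ (Set.Icc 0 n) F σ)]
  congr 1
  rw [Finset.mul_sum, Finset.mul_sum]
  refine Finset.sum_congr rfl fun x hx => ?_
  by_cases hc : σ = Function.update η x (σ x)
  · have hc' : η = Function.update σ x (η x) := by
      rw [hc]; simp
    rw [if_pos hc, if_pos hc', heatBath_eq β Λ ξ n F η x hx, heatBath_eq β Λ ξ n F σ x hx,
      ← hc, ← hc']
    have : Zx β Λ ξ n F σ x = Zx β Λ ξ n F η x := by
      unfold Zx; rw [hc]; simp only [Function.update_idem]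
    rw [this]; ring
  · have hc' : ¬ η = Function.update σ x (η x) := by
      intro e; apply hc; rw [e]; simp
    rw [if_neg hc, if_neg hc']; simp

lemma glauber_chain (hΛ : Λ.Nonempty) :
    ChainHyp (Om Λ ξ n) (gWeight β Λ ξ (Set.Icc 0 n) F) (glauber β Λ ξ (Set.Icc 0 n) F) := by
  have h1 : ∀ η ∈ Om Λ ξ n, ∑ σ ∈ Om Λ ξ n, glauber β Λ ξ (Set.Icc 0 n) F η σ = 1 := by
    intro η hη
    have := glauber_sum β Λ ξ n F η hη (fun _ => 1)
    simp only [mul_one] at this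
    rw [this, Finset.sum_congr rfl (fun x hx => heatBath_sum β Λ ξ n F η hη x hx)]
    have : (Λ.card : ℝ) ≠ 0 := by exact_mod_cast hΛ.card_pos.ne'
    simp [this]
  refine ⟨fun η hη => gWeight_pos β Λ ξ n F η hη, ?_, ?_, h1, ?_⟩
  · intro η hη σ
    unfold glauber
    refine mul_nonneg (by positivity) (Finset.sum_nonneg fun x hx => ?_)
    split_ifs
    · exact heatBath_nonneg β Λ ξ n F η x hx _
    · exact le_rfl
  · intro η hη σ hσ
    unfold glauber
    rw [Finset.sum_eq_zero, mul_zero]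
    intro x hx
    split_ifs with hc
    · rw [heatBath_eq β Λ ξ n F η x hx, gWeight_zero, zero_div]
      intro hh
      apply hσ
      rw [hc]
      apply update_mem_Om Λ ξ n η hη x hx
      have := hh x hx
      rw [Function.update_self] at this
      exact Finset.mem_Icc.2 this
    · rfl
  · intro σ hσ
    rw [Finset.sum_congr rfl (fun η hη => glauber_symm β Λ ξ n F η σ hη hσ), ← Finset.mul_sum,
      h1 σ hσ, mul_one]

def Dx (f : Config → ℝ) (x : Site) (τ : Config) : ℝ :=
  ∑ v ∈ Finset.Icc 0 n, heatBath β Λ ξ (Set.Icc 0 n) F τ x v *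
    (f τ - f (Function.update τ x v)) ^ 2

lemma Dx_nonneg (f : Config → ℝ) (x : Site) (hx : x ∈ Λ) (τ : Config) :
    0 ≤ Dx β Λ ξ n F f x τ :=
  Finset.sum_nonneg fun v _ => mul_nonneg (heatBath_nonneg β Λ ξ n F τ x hx v) (sq_nonneg _)

lemma sum_Dx (hΛ : Λ.Nonempty) (f : Config → ℝ) :
    ∑ x ∈ Λ, ∑ τ ∈ Om Λ ξ n, gWeight β Λ ξ (Set.Icc 0 n) F τ * Dx β Λ ξ n F f x τ
      = Λ.card * enA (Om Λ ξ n) (gWeight β Λ ξ (Set.Icc 0 n) F)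
          (glauber β Λ ξ (Set.Icc 0 n) F) f := by
  have hc : (Λ.card : ℝ) ≠ 0 := by exact_mod_cast hΛ.card_pos.ne'
  unfold enA
  rw [Finset.mul_sum, Finset.sum_comm]
  refine Finset.sum_congr rfl fun τ hτ => ?_
  have := glauber_sum β Λ ξ n F τ hτ (fun σ => (f τ - f σ) ^ 2)
  simp_rw [mul_assoc (gWeight β Λ ξ (Set.Icc 0 n) F τ)]
  rw [← Finset.mul_sum, ← Finset.mul_sum, this]
  simp only [Dx]
  field_simp

lemma Dx_step (f : Config → ℝ) (x : Site) (hx : x ∈ Λ) (σ : Config) (hσ : σ ∈ Om Λ ξ n)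
    (v : ℤ) :
    (f σ - f (Function.update σ x v)) ^ 2 ≤
      2 * (Dx β Λ ξ n F f x σ + Dx β Λ ξ n F f x (Function.update σ x v)) := by
  unfold Dx
  rw [← Finset.sum_add_distrib, Finset.mul_sum]
  calc (f σ - f (Function.update σ x v)) ^ 2
      = ∑ u ∈ Finset.Icc 0 n, heatBath β Λ ξ (Set.Icc 0 n) F σ x u *
          (f σ - f (Function.update σ x v)) ^ 2 := by
        rw [← Finset.sum_mul, heatBath_sum β Λ ξ n F σ hσ x hx, one_mul]
    _ ≤ _ := by
      refine Finset.sum_le_sum fun u _ => ?_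
      rw [heatBath_update, Function.update_idem]
      have h1 := heatBath_nonneg β Λ ξ n F σ x hx u
      nlinarith [mul_nonneg h1 (sq_nonneg ((f σ - f (Function.update σ x u)) +
        (f (Function.update σ x v) - f (Function.update σ x u))))]

end HeatBath

section Paths

def mix (r : Site → ℕ) (k : ℕ) (a b : Config) : Config := fun x => if r x < k then b x else a x

variable (β : ℝ) (Λ : Finset Site) (ξ : Config) (n : ℤ) (F : Config → ℝ)

lemma mix_mem (r : Site → ℕ) (k : ℕ) (a b : Config) (ha : a ∈ Om Λ ξ n) (hb : b ∈ Om Λ ξ n) :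
    mix r k a b ∈ Om Λ ξ n := by
  rw [mem_Om] at *
  refine ⟨fun x hx => ?_, fun x hx => ?_⟩
  · unfold mix; split_ifs
    · exact hb.1 x hx
    · exact ha.1 x hx
  · unfold mix; split_ifs
    · exact hb.2 x hx
    · exact ha.2 x hx

lemma mix_mix (r : Site → ℕ) (k : ℕ) (a b : Config) :
    mix r k (mix r k a b) (mix r k b a) = a := by
  funext x; unfold mix; split_ifs <;> rfl

lemma mix_succ (r : Site → ℕ) (hr : Set.InjOn r Λ) (a b : Config) (ha : a ∈ Om Λ ξ n)
    (hb : b ∈ Om Λ ξ n) (x : Site) (hx : x ∈ Λ) :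
    mix r (r x + 1) a b = Function.update (mix r (r x) a b) x (b x) := by
  rw [mem_Om] at *
  funext y
  by_cases hyx : y = x
  · subst hyx; simp [mix]
  · rw [Function.update_of_ne hyx]
    by_cases hy : y ∈ Λ
    · have : r y ≠ r x := fun e => hyx (hr hy hx e)
      have h2 : r y < r x + 1 ↔ r y < r x := by omega
      simp only [mix, h2]
    · unfold mix
      have : a y = b y := by rw [ha.2 y hy, hb.2 y hy]
      simp [this]

lemma mix_noop (r : Site → ℕ) (a b : Config) (ha : a ∈ Om Λ ξ n)
    (hb : b ∈ Om Λ ξ n) (k : ℕ) (hk : ∀ x ∈ Λ, r x ≠ k) :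
    mix r (k + 1) a b = mix r k a b := by
  rw [mem_Om] at *
  funext y
  by_cases hy : y ∈ Λ
  · have := hk y hy
    have h2 : r y < k + 1 ↔ r y < k := by omega
    simp only [mix, h2]
  · unfold mix
    have : a y = b y := by rw [ha.2 y hy, hb.2 y hy]
    simp [this]

lemma path_le (r : Site → ℕ) (hr : Set.InjOn r Λ) (K : ℕ) (hK : ∀ x ∈ Λ, r x < K)
    (f : Config → ℝ) (a b : Config) (ha : a ∈ Om Λ ξ n) (hb : b ∈ Om Λ ξ n) :
    (f b - f a) ^ 2 ≤ K * ∑ x ∈ Λ, 2 * (Dx β Λ ξ n F f x (mix r (r x) a b) +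
      Dx β Λ ξ n F f x (mix r (r x + 1) a b)) := by
  have e0 : mix r 0 a b = a := by funext x; simp [mix]
  have eK : mix r K a b = b := by
    rw [mem_Om] at *
    funext x
    by_cases hx : x ∈ Λ
    · simp [mix, hK x hx]
    · have : a x = b x := by rw [ha.2 x hx, hb.2 x hx]
      simp [mix, this]
  set g : ℕ → ℝ := fun k => f (mix r k a b) with hg
  have e1 : f b - f a = ∑ k ∈ Finset.range K, (g (k + 1) - g k) := by
    rw [Finset.sum_range_sub]; simp only [hg, e0, eK]
  have e2 : (f b - f a) ^ 2 ≤ K * ∑ k ∈ Finset.range K, (g (k + 1) - g k) ^ 2 := by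
    rw [e1]
    simpa using sq_sum_le_card_mul_sum_sq (s := Finset.range K) (f := fun k => g (k + 1) - g k)
  have e3 : ∑ k ∈ Finset.range K, (g (k + 1) - g k) ^ 2
      = ∑ x ∈ Λ, (g (r x + 1) - g (r x)) ^ 2 := by
    rw [← Finset.sum_image (s := Λ) (g := r) (f := fun k => (g (k + 1) - g k) ^ 2) hr]
    symm
    apply Finset.sum_subset
    · intro k hk
      obtain ⟨x, hx, rfl⟩ := Finset.mem_image.1 hk
      exact Finset.mem_range.2 (hK x hx)
    · intro k _ hk
      have : mix r (k + 1) a b = mix r k a b := by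
        apply mix_noop Λ ξ n r a b ha hb k
        intro x hx e
        exact hk (Finset.mem_image.2 ⟨x, hx, e⟩)
      simp only [hg, this, sub_self]
      norm_num
  rw [e3] at e2
  refine e2.trans (mul_le_mul_of_nonneg_left (Finset.sum_le_sum fun x hx => ?_) (by positivity))
  have := Dx_step β Λ ξ n F f x hx (mix r (r x) a b) (mix_mem Λ ξ n r _ a b ha hb) (b x)
  rw [← mix_succ Λ ξ n r hr a b ha hb x hx] at this
  simp only [hg]
  linarith [sub_sq_comm (f (mix r (r x) a b)) (f (mix r (r x + 1) a b))]

lemma mix_sum_le (r : Site → ℕ) (k : ℕ) (G : Finset Config) (hG : G ⊆ Om Λ ξ n) (M : ℝ)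
    (w : Config → ℝ) (hw : ∀ η, 0 ≤ w η) (hM0 : 0 ≤ M)
    (hM : ∀ a ∈ G, ∀ b ∈ G, w a * w b ≤ M * (w (mix r k a b) * w (mix r k b a)))
    (D : Config → ℝ) (hD : ∀ η, 0 ≤ D η) :
    ∑ a ∈ G, w a * ∑ b ∈ G, w b * D (mix r k a b)
      ≤ M * ((∑ η ∈ Om Λ ξ n, w η) * ∑ η ∈ Om Λ ξ n, w η * D η) := by
  calc ∑ a ∈ G, w a * ∑ b ∈ G, w b * D (mix r k a b)
      = ∑ q ∈ G ×ˢ G, w q.1 * w q.2 * D (mix r k q.1 q.2) := by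
        rw [Finset.sum_product]
        refine Finset.sum_congr rfl fun a _ => ?_
        rw [Finset.mul_sum]
        exact Finset.sum_congr rfl fun b _ => by ring
    _ ≤ ∑ q ∈ G ×ˢ G, M * (w (mix r k q.1 q.2) * w (mix r k q.2 q.1) * D (mix r k q.1 q.2)) := by
        refine Finset.sum_le_sum fun q hq => ?_
        rw [Finset.mem_product] at hq
        have := mul_le_mul_of_nonneg_right (hM q.1 hq.1 q.2 hq.2) (hD (mix r k q.1 q.2))
        linarith
    _ = M * ∑ q ∈ (G ×ˢ G).image (fun q => (mix r k q.1 q.2, mix r k q.2 q.1)),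
          w q.1 * w q.2 * D q.1 := by
        rw [← Finset.mul_sum, Finset.sum_image]
        intro q _ q' _ e
        simp only [Prod.mk.injEq] at e
        ext1
        · rw [← mix_mix r k q.1 q.2, e.1, e.2, mix_mix]
        · rw [← mix_mix r k q.2 q.1, e.1, e.2, mix_mix]
    _ ≤ M * ∑ q ∈ Om Λ ξ n ×ˢ Om Λ ξ n, w q.1 * w q.2 * D q.1 := by
        refine mul_le_mul_of_nonneg_left ?_ hM0
        apply Finset.sum_le_sum_of_subset_of_nonneg
        · intro q hq
          obtain ⟨q', hq', rfl⟩ := Finset.mem_image.1 hq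
          rw [Finset.mem_product] at hq' ⊢
          exact ⟨mix_mem Λ ξ n r k _ _ (hG hq'.1) (hG hq'.2),
            mix_mem Λ ξ n r k _ _ (hG hq'.2) (hG hq'.1)⟩
        · intro q _ _
          exact mul_nonneg (mul_nonneg (hw _) (hw _)) (hD _)
    _ = _ := by
        congr 1
        rw [Finset.sum_product_right, Finset.sum_mul]
        refine Finset.sum_congr rfl fun b _ => ?_
        rw [Finset.mul_sum]
        exact Finset.sum_congr rfl fun a _ => by ring

lemma good_var (r : Site → ℕ) (hr : Set.InjOn r Λ) (K : ℕ) (hK : ∀ x ∈ Λ, r x < K)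
    (G : Finset Config) (hG : G ⊆ Om Λ ξ n) (M : ℝ) (hM0 : 0 ≤ M) (w : Config → ℝ)
    (hwdef : w = gWeight β Λ ξ (Set.Icc 0 n) F)
    (hM : ∀ k, ∀ a ∈ G, ∀ b ∈ G, w a * w b ≤ M * (w (mix r k a b) * w (mix r k b a)))
    (f : Config → ℝ) :
    ∑ a ∈ G, w a * ∑ b ∈ G, w b * (f b - f a) ^ 2 ≤
      4 * K * M * (∑ η ∈ Om Λ ξ n, w η) *
        ∑ x ∈ Λ, ∑ η ∈ Om Λ ξ n, w η * Dx β Λ ξ n F f x η := by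
  have hw : ∀ η, 0 ≤ w η := fun η => by rw [hwdef]; exact gWeight_nonneg β Λ ξ n F η
  calc ∑ a ∈ G, w a * ∑ b ∈ G, w b * (f b - f a) ^ 2
      ≤ ∑ a ∈ G, w a * ∑ b ∈ G, w b * (K * ∑ x ∈ Λ, 2 * (Dx β Λ ξ n F f x (mix r (r x) a b) +
          Dx β Λ ξ n F f x (mix r (r x + 1) a b))) := by
        refine Finset.sum_le_sum fun a ha => mul_le_mul_of_nonneg_left ?_ (hw a)
        refine Finset.sum_le_sum fun b hb => mul_le_mul_of_nonneg_left ?_ (hw b)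
        exact path_le β Λ ξ n F r hr K hK f a b (hG ha) (hG hb)
    _ = 2 * K * ∑ x ∈ Λ, ((∑ a ∈ G, w a * ∑ b ∈ G, w b * Dx β Λ ξ n F f x (mix r (r x) a b))
          + ∑ a ∈ G, w a * ∑ b ∈ G, w b * Dx β Λ ξ n F f x (mix r (r x + 1) a b)) := by
        simp_rw [← Finset.sum_add_distrib, ← mul_add, ← Finset.sum_add_distrib, ← mul_add,
          Finset.mul_sum]
        symm
        rw [Finset.sum_comm]
        symm
        refine Finset.sum_congr rfl fun a _ => ?_
        rw [Finset.sum_comm]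
        exact Finset.sum_congr rfl fun x _ => Finset.sum_congr rfl fun b _ => by ring
    _ ≤ 2 * K * ∑ x ∈ Λ, (2 * (M * ((∑ η ∈ Om Λ ξ n, w η) *
          ∑ η ∈ Om Λ ξ n, w η * Dx β Λ ξ n F f x η))) := by
        refine mul_le_mul_of_nonneg_left (Finset.sum_le_sum fun x hx => ?_) (by positivity)
        have h1 := mix_sum_le Λ ξ n r (r x) G hG M w hw hM0 (hM (r x)) _
          (Dx_nonneg β Λ ξ n F f x hx)
        have h2 := mix_sum_le Λ ξ n r (r x + 1) G hG M w hw hM0 (hM (r x + 1)) _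
          (Dx_nonneg β Λ ξ n F f x hx)
        linarith
    _ = _ := by
        simp_rw [← Finset.mul_sum]; ring

end Paths

section Energy

def dIdx (L : ℕ) (x : Site) : ℕ := (x.1 + L - x.2).toNat

def rKey (L : ℕ) (x : Site) : ℕ := (L + 1) * dIdx L x + x.1.toNat

lemma mem_box (L : ℕ) (x : Site) :
    x ∈ box L ↔ (1 ≤ x.1 ∧ x.1 ≤ L) ∧ (1 ≤ x.2 ∧ x.2 ≤ L) := by
  unfold box
  rw [Finset.mem_Icc, Prod.le_def, Prod.le_def]
  simp only
  tauto

lemma rKey_div (L : ℕ) (x : Site) (hx : x ∈ box L) : rKey L x / (L + 1) = dIdx L x := by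
  rw [mem_box] at hx
  unfold rKey
  rw [Nat.mul_add_div (by omega), Nat.div_eq_of_lt (by omega), add_zero]

lemma rKey_inj (L : ℕ) : Set.InjOn (rKey L) (box L) := by
  intro x hx y hy h
  have h1 := rKey_div L x hx
  have h2 := rKey_div L y hy
  rw [h] at h1
  have h3 : dIdx L x = dIdx L y := by rw [← h1, h2]
  unfold rKey at h
  rw [h3] at h
  have h4 : x.1.toNat = y.1.toNat := by omega
  have hx' := (mem_box L x).1 hx
  have hy' := (mem_box L y).1 hy
  unfold dIdx at h3
  ext <;> omega

lemma rKey_lt (L : ℕ) (x : Site) (hx : x ∈ box L) : rKey L x < (L + 1) * (2 * L) := by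
  rw [mem_box] at hx
  have h1 : dIdx L x + 1 ≤ 2 * L := by unfold dIdx; omega
  have h2 : (L + 1) * (dIdx L x + 1) ≤ (L + 1) * (2 * L) := Nat.mul_le_mul_left _ h1
  have h3 : x.1.toNat < L + 1 := by omega
  unfold rKey
  nlinarith

lemma mem_diagR (L i : ℕ) (x : Site) (hx : x ∈ box L) : x ∈ diagR L i ↔ dIdx L x = i := by
  unfold diagR dIdx
  rw [Finset.mem_filter]
  have hx' := (mem_box L x).1 hx
  constructor
  · rintro ⟨_, h⟩; omega
  · intro h; exact ⟨hx, by omega⟩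

lemma nbrs_symm (x y : Site) : y ∈ nbrs x ↔ x ∈ nbrs y := by
  simp only [nbrs, Finset.mem_insert, Finset.mem_singleton, Prod.ext_iff]
  omega

/-- split cost -/
def cst (L k : ℕ) (a b : Config) (x y : Site) : ℤ :=
  if x ∈ diagR L (k / (L + 1)) ∧ (rKey L x < k ↔ ¬ rKey L y < k) then 2 * |a x - b x| else 0

lemma cst_nonneg (L k : ℕ) (a b : Config) (x y : Site) : 0 ≤ cst L k a b x y := by
  unfold cst; split_ifs
  · positivity
  · exact le_rfl

lemma bond_le (L k : ℕ) (a b : Config) (x y : Site) (hx : x ∈ box L) (hy : y ∈ box L)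
    (hxy : y ∈ nbrs x) :
    |mix (rKey L) k a b x - mix (rKey L) k a b y| + |mix (rKey L) k b a x - mix (rKey L) k b a y|
      ≤ |a x - a y| + |b x - b y| + (cst L k a b x y + cst L k a b y x) := by
  have c1 := cst_nonneg L k a b x y
  have c2 := cst_nonneg L k a b y x
  by_cases h1 : rKey L x < k <;> by_cases h2 : rKey L y < k
  · simp only [mix, h1, h2, if_true]; linarith
  · have hs : x ∈ diagR L (k / (L + 1)) ∨ y ∈ diagR L (k / (L + 1)) := by
      rw [mem_diagR L _ x hx, mem_diagR L _ y hy]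
      have e1 : rKey L x / (L + 1) ≤ k / (L + 1) := Nat.div_le_div_right h1.le
      have e2 : k / (L + 1) ≤ rKey L y / (L + 1) := Nat.div_le_div_right (by omega)
      rw [rKey_div L x hx] at e1
      rw [rKey_div L y hy] at e2
      have hx' := (mem_box L x).1 hx
      have hy' := (mem_box L y).1 hy
      simp only [nbrs, Finset.mem_insert, Finset.mem_singleton, Prod.ext_iff] at hxy
      unfold dIdx at *
      omega
    simp only [mix, h1, h2, if_true, if_false]
    rcases hs with hs | hs
    · have : cst L k a b x y = 2 * |a x - b x| := by
        unfold cst; rw [if_pos ⟨hs, by simp [h1, h2]⟩]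
      have t1 := abs_sub_le (b x) (a x) (a y)
      have t2 := abs_sub_le (a x) (b x) (b y)
      have t3 := abs_sub_comm (a x) (b x)
      linarith
    · have : cst L k a b y x = 2 * |a y - b y| := by
        unfold cst; rw [if_pos ⟨hs, by simp [h1, h2]⟩]
      have t1 := abs_sub_le (b x) (b y) (a y)
      have t2 := abs_sub_le (a x) (a y) (b y)
      have t3 := abs_sub_comm (a y) (b y)
      linarith
  · have hs : x ∈ diagR L (k / (L + 1)) ∨ y ∈ diagR L (k / (L + 1)) := by
      rw [mem_diagR L _ x hx, mem_diagR L _ y hy]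
      have e1 : rKey L y / (L + 1) ≤ k / (L + 1) := Nat.div_le_div_right h2.le
      have e2 : k / (L + 1) ≤ rKey L x / (L + 1) := Nat.div_le_div_right (by omega)
      rw [rKey_div L y hy] at e1
      rw [rKey_div L x hx] at e2
      have hx' := (mem_box L x).1 hx
      have hy' := (mem_box L y).1 hy
      simp only [nbrs, Finset.mem_insert, Finset.mem_singleton, Prod.ext_iff] at hxy
      unfold dIdx at *
      omega
    simp only [mix, h1, h2, if_true, if_false]
    rcases hs with hs | hs
    · have : cst L k a b x y = 2 * |a x - b x| := by
        unfold cst; rw [if_pos ⟨hs, by simp [h1, h2]⟩]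
      have t1 := abs_sub_le (b x) (a x) (a y)
      have t2 := abs_sub_le (a x) (b x) (b y)
      have t3 := abs_sub_comm (a x) (b x)
      linarith
    · have : cst L k a b y x = 2 * |a y - b y| := by
        unfold cst; rw [if_pos ⟨hs, by simp [h1, h2]⟩]
      have t1 := abs_sub_le (b x) (b y) (a y)
      have t2 := abs_sub_le (a x) (a y) (b y)
      have t3 := abs_sub_comm (a y) (b y)
      linarith
  · simp only [mix, h1, h2, if_false]; linarith

lemma cst_row (L k : ℕ) (a b : Config) (x : Site) (hx : x ∈ box L) :
    ∑ y ∈ (nbrs x).filter (fun y => y ∈ box L), cst L k a b x y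
      ≤ if x ∈ diagR L (k / (L + 1)) then 4 * |a x - b x| else 0 := by
  split_ifs with hR
  · have hcard : (((nbrs x).filter (fun y => y ∈ box L)).filter
        (fun y => (rKey L x < k ↔ ¬ rKey L y < k))).card ≤ 2 := by
      have hd := (mem_diagR L _ x hx).1 hR
      by_cases h1 : rKey L x < k
      · refine (Finset.card_le_card (t := {(x.1 + 1, x.2), (x.1, x.2 - 1)}) ?_).trans
          Finset.card_le_two
        intro y hy
        simp only [Finset.mem_filter, h1, true_iff] at hy
        obtain ⟨⟨hyn, hyb⟩, hyk⟩ := hy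
        have e2 : k / (L + 1) ≤ rKey L y / (L + 1) := Nat.div_le_div_right (by omega)
        rw [rKey_div L y hyb, ← hd] at e2
        have hx' := (mem_box L x).1 hx
        have hy' := (mem_box L y).1 hyb
        simp only [nbrs, Finset.mem_insert, Finset.mem_singleton, Prod.ext_iff] at hyn ⊢
        unfold dIdx at e2
        omega
      · refine (Finset.card_le_card (t := {(x.1 - 1, x.2), (x.1, x.2 + 1)}) ?_).trans
          Finset.card_le_two
        intro y hy
        simp only [Finset.mem_filter, h1, false_iff, not_not] at hy
        obtain ⟨⟨hyn, hyb⟩, hyk⟩ := hy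
        have e2 : rKey L y / (L + 1) ≤ k / (L + 1) := Nat.div_le_div_right hyk.le
        rw [rKey_div L y hyb, ← hd] at e2
        have hx' := (mem_box L x).1 hx
        have hy' := (mem_box L y).1 hyb
        simp only [nbrs, Finset.mem_insert, Finset.mem_singleton, Prod.ext_iff] at hyn ⊢
        unfold dIdx at e2
        omega
    unfold cst
    simp only [hR, true_and]
    rw [← Finset.sum_filter, Finset.sum_const, nsmul_eq_mul]
    have h0 := abs_nonneg (a x - b x)
    have hc : ((((nbrs x).filter (fun y => y ∈ box L)).filter
        (fun y => (rKey L x < k ↔ ¬ rKey L y < k))).card : ℤ) ≤ 2 := by exact_mod_cast hcard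
    nlinarith
  · apply le_of_eq
    refine Finset.sum_eq_zero fun y _ => ?_
    unfold cst; rw [if_neg]; tauto

lemma diag_diff (β : ℝ) (L : ℕ) (ℓ : ℝ) (hℓ : 0 < ℓ) (a b : Config) (ha : a ∈ Gabs β L ℓ)
    (hb : b ∈ Gabs β L ℓ) (i : ℕ) :
    ((∑ x ∈ diagR L i, |a x - b x| : ℤ) : ℝ) ≤ 2 * (L * ℓ) := by
  by_cases hi : i ∈ Finset.Icc 1 (2 * L - 1)
  · have h1 := ha i hi
    have h2 := hb i hi
    have h3 : ∑ x ∈ diagR L i, |a x - b x| ≤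
        ∑ x ∈ diagR L i, |a x - eqHt β L| + ∑ x ∈ diagR L i, |b x - eqHt β L| := by
      rw [← Finset.sum_add_distrib]
      refine Finset.sum_le_sum fun x _ => ?_
      have := abs_sub_le (a x) (eqHt β L) (b x)
      rwa [abs_sub_comm (eqHt β L) (b x)] at this
    have h4 : ((∑ x ∈ diagR L i, |a x - b x| : ℤ) : ℝ) ≤
        ((∑ x ∈ diagR L i, |a x - eqHt β L| : ℤ) : ℝ)
          + ((∑ x ∈ diagR L i, |b x - eqHt β L| : ℤ) : ℝ) := by exact_mod_cast h3
    linarith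
  · have : diagR L i = ∅ := by
      rw [Finset.eq_empty_iff_forall_notMem]
      intro x hx
      have hxb : x ∈ box L := (Finset.mem_filter.1 hx).1
      have hd := (mem_diagR L i x hxb).1 hx
      have hx' := (mem_box L x).1 hxb
      apply hi
      rw [Finset.mem_Icc]
      unfold dIdx at hd
      omega
    rw [this]
    simp only [Finset.sum_empty, Int.cast_zero]
    positivity

lemma energy_le (β : ℝ) (L : ℕ) (ℓ : ℝ) (hℓ : 0 < ℓ) (a b : Config) (ha : a ∈ Gabs β L ℓ)
    (hb : b ∈ Gabs β L ℓ) (k : ℕ) :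
    sosH (box L) 0 (mix (rKey L) k a b) + sosH (box L) 0 (mix (rKey L) k b a)
      ≤ sosH (box L) 0 a + sosH (box L) 0 b + 8 * (L * ℓ) := by
  set σ := mix (rKey L) k a b with hσ
  set τ := mix (rKey L) k b a with hτ
  have hbd : ∑ x ∈ box L, ∑ y ∈ (nbrs x).filter (fun y => y ∉ box L),
        ((|σ x - (0 : Config) y| : ℤ) : ℝ)
      + ∑ x ∈ box L, ∑ y ∈ (nbrs x).filter (fun y => y ∉ box L),
        ((|τ x - (0 : Config) y| : ℤ) : ℝ)
      = ∑ x ∈ box L, ∑ y ∈ (nbrs x).filter (fun y => y ∉ box L),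
        ((|a x - (0 : Config) y| : ℤ) : ℝ)
      + ∑ x ∈ box L, ∑ y ∈ (nbrs x).filter (fun y => y ∉ box L),
        ((|b x - (0 : Config) y| : ℤ) : ℝ) := by
    simp_rw [← Finset.sum_add_distrib]
    refine Finset.sum_congr rfl fun x _ => Finset.sum_congr rfl fun y _ => ?_
    simp only [hσ, hτ, mix]
    split_ifs
    · ring
    · ring
  set C : ℤ := ∑ x ∈ box L, ∑ y ∈ (nbrs x).filter (fun y => y ∈ box L), cst L k a b x y with hC
  have hsym : ∑ x ∈ box L, ∑ y ∈ (nbrs x).filter (fun y => y ∈ box L), cst L k a b y x = C := by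
    rw [hC]
    apply Finset.sum_comm'
    intro x y
    simp only [Finset.mem_filter]
    rw [nbrs_symm x y]
    tauto
  have hin : ∑ x ∈ box L, ∑ y ∈ (nbrs x).filter (fun y => y ∈ box L), |σ x - σ y|
      + ∑ x ∈ box L, ∑ y ∈ (nbrs x).filter (fun y => y ∈ box L), |τ x - τ y|
      ≤ ∑ x ∈ box L, ∑ y ∈ (nbrs x).filter (fun y => y ∈ box L), |a x - a y|
      + ∑ x ∈ box L, ∑ y ∈ (nbrs x).filter (fun y => y ∈ box L), |b x - b y| + (C + C) := by
    nth_rewrite 2 [← hsym]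
    rw [hC]
    simp_rw [← Finset.sum_add_distrib]
    refine Finset.sum_le_sum fun x hx => Finset.sum_le_sum fun y hy => ?_
    rw [Finset.mem_filter] at hy
    have := bond_le L k a b x y hx hy.2 hy.1
    linarith
  have hCle : C ≤ 4 * ∑ x ∈ diagR L (k / (L + 1)), |a x - b x| := by
    calc C ≤ ∑ x ∈ box L, if x ∈ diagR L (k / (L + 1)) then 4 * |a x - b x| else 0 :=
          Finset.sum_le_sum fun x hx => cst_row L k a b x hx
      _ = _ := by
        rw [← Finset.sum_filter, Finset.mul_sum]
        congr 1
        ext x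
        simp only [diagR, Finset.mem_filter]
        tauto
  have hd := diag_diff β L ℓ hℓ a b ha hb (k / (L + 1))
  have hin' : (∑ x ∈ box L, ∑ y ∈ (nbrs x).filter (fun y => y ∈ box L), ((|σ x - σ y| : ℤ) : ℝ))
      + ∑ x ∈ box L, ∑ y ∈ (nbrs x).filter (fun y => y ∈ box L), ((|τ x - τ y| : ℤ) : ℝ)
      ≤ (∑ x ∈ box L, ∑ y ∈ (nbrs x).filter (fun y => y ∈ box L), ((|a x - a y| : ℤ) : ℝ))
      + (∑ x ∈ box L, ∑ y ∈ (nbrs x).filter (fun y => y ∈ box L), ((|b x - b y| : ℤ) : ℝ))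
      + ((C : ℝ) + C) := by exact_mod_cast hin
  have hC' : (C : ℝ) ≤ 4 * ((∑ x ∈ diagR L (k / (L + 1)), |a x - b x| : ℤ) : ℝ) := by
    exact_mod_cast hCle
  unfold sosH
  linarith

lemma field_mix (β : ℝ) (L : ℕ) (r : Site → ℕ) (k : ℕ) (a b : Config) :
    fieldF β L (box L) (mix r k a b) + fieldF β L (box L) (mix r k b a)
      = fieldF β L (box L) a + fieldF β L (box L) b := by
  unfold fieldF
  rw [← mul_add, ← mul_add, ← Finset.sum_add_distrib, ← Finset.sum_add_distrib]
  congr 1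
  refine Finset.sum_congr rfl fun y _ => ?_
  unfold mix
  by_cases h : r y < k
  · simp only [h, if_true]; rw [add_comm]
  · simp only [h, if_false]

lemma weight_mix (β : ℝ) (hβ : 0 < β) (L : ℕ) (n : ℤ) (ℓ : ℝ) (hℓ : 0 < ℓ) (a b : Config)
    (ha : a ∈ Gabs β L ℓ) (hb : b ∈ Gabs β L ℓ) (ha' : a ∈ Om (box L) 0 n)
    (hb' : b ∈ Om (box L) 0 n) (k : ℕ) :
    gWeight β (box L) 0 (Set.Icc 0 n) (fieldF β L (box L)) a *
      gWeight β (box L) 0 (Set.Icc 0 n) (fieldF β L (box L)) b ≤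
    Real.exp (8 * β * (L * ℓ)) *
      (gWeight β (box L) 0 (Set.Icc 0 n) (fieldF β L (box L)) (mix (rKey L) k a b) *
      gWeight β (box L) 0 (Set.Icc 0 n) (fieldF β L (box L)) (mix (rKey L) k b a)) := by
  rw [gWeight_Om _ _ _ _ _ _ ha', gWeight_Om _ _ _ _ _ _ hb',
    gWeight_Om _ _ _ _ _ _ (mix_mem _ _ _ _ k a b ha' hb'),
    gWeight_Om _ _ _ _ _ _ (mix_mem _ _ _ _ k b a hb' ha'), ← Real.exp_add, ← Real.exp_add,
    ← Real.exp_add]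
  apply Real.exp_le_exp.2
  have h1 := energy_le β L ℓ hℓ a b ha hb k
  have h2 := field_mix β L (rKey L) k a b
  nlinarith [mul_le_mul_of_nonneg_left h1 hβ.le]

end Energy

section Flip

lemma nbrs_card (x : Site) : (nbrs x).card ≤ 4 := by
  unfold nbrs
  exact Finset.card_le_four

lemma sosH_lip (Λ : Finset Site) (ξ σ η : Config) :
    sosH Λ ξ σ ≤ sosH Λ ξ η + 4 * ∑ x ∈ Λ, ((|σ x - η x| : ℤ) : ℝ) := by
  have tri : ∀ x y, ((|σ x - σ y| : ℤ) : ℝ) ≤ ((|η x - η y| : ℤ) : ℝ) +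
      (((|σ x - η x| : ℤ) : ℝ) + ((|σ y - η y| : ℤ) : ℝ)) := by
    intro x y
    have : |σ x - σ y| ≤ |η x - η y| + (|σ x - η x| + |σ y - η y|) := by
      have t1 := abs_sub_le (σ x) (η x) (σ y)
      have t2 := abs_sub_le (η x) (η y) (σ y)
      rw [abs_sub_comm (η y) (σ y)] at t2
      linarith
    exact_mod_cast this
  have tri2 : ∀ x y, ((|σ x - ξ y| : ℤ) : ℝ) ≤ ((|η x - ξ y| : ℤ) : ℝ) +
      ((|σ x - η x| : ℤ) : ℝ) := by
    intro x y
    have : |σ x - ξ y| ≤ |η x - ξ y| + |σ x - η x| := by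
      have t1 := abs_sub_le (σ x) (η x) (ξ y)
      linarith
    exact_mod_cast this
  have h1 : ∑ x ∈ Λ, ∑ y ∈ (nbrs x).filter (fun y => y ∈ Λ), ((|σ x - σ y| : ℤ) : ℝ) ≤
      ∑ x ∈ Λ, ∑ y ∈ (nbrs x).filter (fun y => y ∈ Λ), ((|η x - η y| : ℤ) : ℝ)
      + (∑ x ∈ Λ, ∑ y ∈ (nbrs x).filter (fun y => y ∈ Λ), ((|σ x - η x| : ℤ) : ℝ)
      + ∑ x ∈ Λ, ∑ y ∈ (nbrs x).filter (fun y => y ∈ Λ), ((|σ y - η y| : ℤ) : ℝ)) := by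
    simp_rw [← Finset.sum_add_distrib]
    exact Finset.sum_le_sum fun x _ => Finset.sum_le_sum fun y _ => tri x y
  have hsym : ∑ x ∈ Λ, ∑ y ∈ (nbrs x).filter (fun y => y ∈ Λ), ((|σ y - η y| : ℤ) : ℝ)
      = ∑ x ∈ Λ, ∑ y ∈ (nbrs x).filter (fun y => y ∈ Λ), ((|σ x - η x| : ℤ) : ℝ) := by
    apply Finset.sum_comm'
    intro x y
    simp only [Finset.mem_filter]
    rw [nbrs_symm x y]
    tauto
  have h2 : ∑ x ∈ Λ, ∑ y ∈ (nbrs x).filter (fun y => y ∉ Λ), ((|σ x - ξ y| : ℤ) : ℝ) ≤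
      ∑ x ∈ Λ, ∑ y ∈ (nbrs x).filter (fun y => y ∉ Λ), ((|η x - ξ y| : ℤ) : ℝ)
      + ∑ x ∈ Λ, ∑ y ∈ (nbrs x).filter (fun y => y ∉ Λ), ((|σ x - η x| : ℤ) : ℝ) := by
    simp_rw [← Finset.sum_add_distrib]
    exact Finset.sum_le_sum fun x _ => Finset.sum_le_sum fun y _ => tri2 x y
  have h3 : ∑ x ∈ Λ, ∑ y ∈ (nbrs x).filter (fun y => y ∈ Λ), ((|σ x - η x| : ℤ) : ℝ)
      + ∑ x ∈ Λ, ∑ y ∈ (nbrs x).filter (fun y => y ∉ Λ), ((|σ x - η x| : ℤ) : ℝ)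
      ≤ 4 * ∑ x ∈ Λ, ((|σ x - η x| : ℤ) : ℝ) := by
    rw [← Finset.sum_add_distrib, Finset.mul_sum]
    refine Finset.sum_le_sum fun x _ => ?_
    rw [Finset.sum_filter_add_sum_filter_not, Finset.sum_const, nsmul_eq_mul]
    refine mul_le_mul_of_nonneg_right ?_ (by positivity)
    exact_mod_cast nbrs_card x
  unfold sosH
  rw [hsym] at h1
  linarith

def flipV (β : ℝ) (L : ℕ) : ℤ := if eqHt β L + 1 ≤ ceilN L then eqHt β L + 1 else eqHt β L - 1

lemma flip_abs (β : ℝ) (L : ℕ) : |flipV β L - eqHt β L| = 1 := by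
  unfold flipV; split_ifs <;> simp

lemma flip_field (β : ℝ) (L : ℕ) (η : Config) (x : Site) (hx : η x = eqHt β L) :
    fieldF β L (box L) (Function.update η x (flipV β L)) = fieldF β L (box L) η := by
  unfold fieldF
  congr 1
  refine Finset.sum_congr rfl fun y _ => Finset.sum_congr rfl fun j hj => ?_
  rw [Finset.mem_Icc] at hj
  by_cases hyx : y = x
  · subst hyx
    rw [Function.update_self, hx]
    have : flipV β L ≤ eqHt β L + 1 := by unfold flipV; split_ifs <;> omega
    rw [if_pos (by omega), if_pos (by omega)]
  · rw [Function.update_of_ne hyx]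

lemma flip_weight (β : ℝ) (hβ : 0 < β) (L : ℕ) (hn : 1 ≤ ceilN L) (η : Config)
    (hη : η ∈ Om (box L) 0 (ceilN L)) (x : Site) (hxb : x ∈ box L) (hx : η x = eqHt β L) :
    Function.update η x (flipV β L) ∈ Om (box L) 0 (ceilN L) ∧
    gWeight β (box L) 0 (Set.Icc 0 (ceilN L)) (fieldF β L (box L)) η ≤
      Real.exp (4 * β) * gWeight β (box L) 0 (Set.Icc 0 (ceilN L)) (fieldF β L (box L))
        (Function.update η x (flipV β L)) := by
  have hK := ((mem_Om _ _ _ _).1 hη).1 x hxb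
  rw [hx, Set.mem_Icc] at hK
  have hm : Function.update η x (flipV β L) ∈ Om (box L) 0 (ceilN L) := by
    apply update_mem_Om _ _ _ _ hη x hxb
    rw [Finset.mem_Icc]
    unfold flipV; split_ifs <;> omega
  refine ⟨hm, ?_⟩
  rw [gWeight_Om _ _ _ _ _ _ hη, gWeight_Om _ _ _ _ _ _ hm, ← Real.exp_add, flip_field β L η x hx]
  apply Real.exp_le_exp.2
  have h1 := sosH_lip (box L) 0 (Function.update η x (flipV β L)) η
  have h2 : ∑ y ∈ box L, ((|Function.update η x (flipV β L) y - η y| : ℤ) : ℝ) = 1 := by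
    rw [Finset.sum_eq_single_of_mem x hxb]
    · rw [Function.update_self, hx, flip_abs]; simp
    · intro y _ hyx
      rw [Function.update_of_ne hyx]; simp
  rw [h2] at h1
  nlinarith

lemma diag_card (L : ℕ) : (diagR L L).card = L := by
  have : diagR L L = (Finset.Icc (1 : ℤ) L).image (fun i => (i, i)) := by
    ext x
    unfold diagR
    rw [Finset.mem_filter, mem_box, Finset.mem_image]
    constructor
    · rintro ⟨h1, h2⟩
      refine ⟨x.1, Finset.mem_Icc.2 h1.1, ?_⟩
      ext
      · rfl
      · simp only; omega
    · rintro ⟨i, hi, rfl⟩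
      rw [Finset.mem_Icc] at hi
      simp only
      omega
  rw [this, Finset.card_image_of_injective _ (fun a b h => (Prod.ext_iff.1 h).1)]
  simp

lemma ell_lower (β : ℝ) (hβ : 0 < β) (L : ℕ) (hn : 1 ≤ ceilN L) (hL : 1 ≤ L) (ℓ α : ℝ)
    (hℓ : 0 < ℓ) (hα : 0 < α) (w : Config → ℝ)
    (hwdef : w = gWeight β (box L) 0 (Set.Icc 0 (ceilN L)) (fieldF β L (box L)))
    (S : Finset Config) (hS : S = Om (box L) 0 (ceilN L))
    (hZ : 0 < ∑ η ∈ S, w η)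
    (hG : α * ∑ η ∈ S, w η ≤ ∑ η ∈ S.filter (fun σ => σ ∈ Gabs β L ℓ), w η) :
    α * (L - L * ℓ) ≤ Real.exp (4 * β) * (L * ℓ + 1) := by
  set s : ℝ := L * ℓ with hs
  have hs0 : 0 < s := by
    have : (0 : ℝ) < L := by exact_mod_cast hL
    positivity
  have hw : ∀ η, 0 ≤ w η := fun η => by rw [hwdef]; exact gWeight_nonneg _ _ _ _ _ η
  by_cases hsL : (L : ℝ) < s
  · have h1 : α * (L - s) ≤ 0 := mul_nonpos_of_nonneg_of_nonpos hα.le (by linarith)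
    have : 0 ≤ Real.exp (4 * β) * (s + 1) := by positivity
    linarith
  set G := S.filter (fun σ => σ ∈ Gabs β L ℓ) with hGd
  set R := diagR L L with hR
  have hRb : ∀ x ∈ R, x ∈ box L := fun x hx => (Finset.mem_filter.1 hx).1
  set H := eqHt β L with hH
  set Sd : Config → ℝ := fun η => ((∑ x ∈ R, |η x - H| : ℤ) : ℝ) with hSd
  have hGS : ∀ η ∈ G, Sd η ≤ s := by
    intro η hη
    exact (Finset.mem_filter.1 hη).2 L (Finset.mem_Icc.2 ⟨hL, by omega⟩)
  set B := S.filter (fun η => Sd η ≤ s + 1) with hB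
  -- single-site comparison
  have hone : ∀ x ∈ R, ∑ η ∈ G.filter (fun η => η x = H), w η ≤
      Real.exp (4 * β) * ∑ η ∈ B.filter (fun η => η x ≠ H), w η := by
    intro x hx
    rw [Finset.mul_sum]
    calc ∑ η ∈ G.filter (fun η => η x = H), w η
        ≤ ∑ η ∈ G.filter (fun η => η x = H),
            Real.exp (4 * β) * w (Function.update η x (flipV β L)) := by
          refine Finset.sum_le_sum fun η hη => ?_
          rw [Finset.mem_filter, hGd, Finset.mem_filter, hS] at hη
          rw [hwdef]
          exact (flip_weight β hβ L hn η hη.1.1 x (hRb x hx) hη.2).2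
      _ = ∑ σ ∈ (G.filter (fun η => η x = H)).image
            (fun η => Function.update η x (flipV β L)), Real.exp (4 * β) * w σ := by
          rw [Finset.sum_image]
          intro η hη σ hσ e
          have hη' := (Finset.mem_filter.1 hη).2
          have hσ' := (Finset.mem_filter.1 hσ).2
          funext y
          by_cases hyx : y = x
          · rw [hyx, hη', hσ']
          · have := congrFun e y
            simpa [Function.update_of_ne hyx] using this
      _ ≤ _ := by
          apply Finset.sum_le_sum_of_subset_of_nonneg
          · intro σ hσ
            obtain ⟨η, hη, rfl⟩ := Finset.mem_image.1 hσ
            rw [Finset.mem_filter] at hη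
            have hηS : η ∈ S := (Finset.mem_filter.1 hη.1).1
            rw [hS] at hηS
            rw [Finset.mem_filter, hB, Finset.mem_filter]
            refine ⟨⟨?_, ?_⟩, ?_⟩
            · rw [hS]
              exact (flip_weight β hβ L hn η hηS x (hRb x hx) hη.2).1
            · have h1 := hGS η hη.1
              have h2 : ∑ y ∈ R, |Function.update η x (flipV β L) y - H| ≤
                  ∑ y ∈ R, |η y - H| + 1 := by
                calc ∑ y ∈ R, |Function.update η x (flipV β L) y - H|
                    ≤ ∑ y ∈ R, (|η y - H| + if y = x then 1 else 0) := by
                      refine Finset.sum_le_sum fun y _ => ?_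
                      by_cases hyx : y = x
                      · subst hyx
                        rw [Function.update_self, hH, flip_abs]; simp
                      · rw [Function.update_of_ne hyx]; simp [hyx]
                  _ = _ := by
                      rw [Finset.sum_add_distrib, Finset.sum_ite_eq']
                      simp [hx]
              have h3 : Sd (Function.update η x (flipV β L)) ≤ Sd η + 1 := by
                simp only [hSd]; exact_mod_cast h2
              linarith
            · rw [Function.update_self]
              intro e
              have := flip_abs β L
              rw [e, ← hH] at this
              simp at this
          · intro σ _ _
            exact mul_nonneg (Real.exp_pos _).le (hw σ)
  have hsw : ∀ (A : Finset Config) (P : Config → Site → Prop) [∀ η x, Decidable (P η x)],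
      ∑ x ∈ R, ∑ η ∈ A.filter (fun η => P η x), w η
        = ∑ η ∈ A, w η * ∑ x ∈ R, if P η x then (1 : ℝ) else 0 := by
    intro A P _
    simp_rw [Finset.sum_filter, Finset.mul_sum]
    rw [Finset.sum_comm]
    refine Finset.sum_congr rfl fun η _ => Finset.sum_congr rfl fun x _ => ?_
    split_ifs <;> simp
  have hlow : (L - s) * ∑ η ∈ G, w η ≤ ∑ x ∈ R, ∑ η ∈ G.filter (fun η => η x = H), w η := by
    rw [hsw G (fun η x => η x = H), Finset.mul_sum]
    refine Finset.sum_le_sum fun η hη => ?_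
    rw [mul_comm]
    refine mul_le_mul_of_nonneg_left ?_ (hw η)
    have h1 := hGS η hη
    have h2 : (L : ℝ) - Sd η ≤ ∑ x ∈ R, if η x = H then (1 : ℝ) else 0 := by
      have : (L : ℝ) = ∑ x ∈ R, (1 : ℝ) := by
        rw [Finset.sum_const, diag_card]; simp
      rw [this]
      simp only [hSd]
      push_cast
      rw [← Finset.sum_sub_distrib]
      refine Finset.sum_le_sum fun x _ => ?_
      split_ifs with hx
      · rw [hx]; simp
      · have : 1 ≤ |η x - H| := Int.one_le_abs (sub_ne_zero.2 hx)
        have h' : (1 : ℝ) ≤ |(η x : ℝ) - H| := by exact_mod_cast this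
        linarith
    linarith
  have hup : ∑ x ∈ R, ∑ η ∈ B.filter (fun η => η x ≠ H), w η ≤ (s + 1) * ∑ η ∈ S, w η := by
    rw [hsw B (fun η x => η x ≠ H), Finset.mul_sum]
    calc ∑ η ∈ B, w η * ∑ x ∈ R, (if η x ≠ H then (1 : ℝ) else 0)
        ≤ ∑ η ∈ B, (s + 1) * w η := by
          refine Finset.sum_le_sum fun η hη => ?_
          rw [mul_comm]
          refine mul_le_mul_of_nonneg_right ?_ (hw η)
          refine le_trans ?_ (Finset.mem_filter.1 hη).2
          simp only [hSd]
          push_cast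
          refine Finset.sum_le_sum fun x _ => ?_
          split_ifs with hx
          · have : 1 ≤ |η x - H| := Int.one_le_abs (sub_ne_zero.2 hx)
            exact_mod_cast this
          · positivity
      _ ≤ _ := Finset.sum_le_sum_of_subset_of_nonneg (Finset.filter_subset _ _)
          fun η _ _ => mul_nonneg (by linarith) (hw η)
  have hmid : ∑ x ∈ R, ∑ η ∈ G.filter (fun η => η x = H), w η ≤
      Real.exp (4 * β) * ∑ x ∈ R, ∑ η ∈ B.filter (fun η => η x ≠ H), w η := by
    rw [Finset.mul_sum]
    exact Finset.sum_le_sum hone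
  have h1 := mul_le_mul_of_nonneg_left hG (show 0 ≤ (L : ℝ) - s by linarith)
  have h2 := mul_le_mul_of_nonneg_left hup (Real.exp_pos (4 * β)).le
  have h3 : (α * (L - s)) * ∑ η ∈ S, w η ≤ (Real.exp (4 * β) * (s + 1)) * ∑ η ∈ S, w η := by
    linarith
  exact le_of_mul_le_mul_right h3 hZ

end Flip

section Final

lemma alg_aux (L : ℕ) (hL : (3 : ℝ) ≤ L) (M Z E : ℝ) (hM : 0 ≤ M) (hZ : 0 ≤ Z) (hE : 0 ≤ E) :
    4 * (((L + 1) * (2 * L) : ℕ) : ℝ) * M * Z * ((L : ℝ) ^ 2 * E) ≤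
        16 * ((L : ℝ) ^ 4 * M) * (Z * E) := by
  have b1 : (((L + 1) * (2 * L) : ℕ) : ℝ) ≤ 4 * (L : ℝ) ^ 2 := by
    push_cast; nlinarith
  have b2 : 0 ≤ 4 * M * Z * ((L : ℝ) ^ 2 * E) := by positivity
  have := mul_le_mul_of_nonneg_right b1 b2
  calc _ = (((L + 1) * (2 * L) : ℕ) : ℝ) * (4 * M * Z * ((L : ℝ) ^ 2 * E)) := by ring
    _ ≤ _ := this
    _ = _ := by ring

set_option maxHeartbeats 2000000 in
lemma poincare_core (β : ℝ) (hβ : 0 < β) (α : ℝ) (hα : 0 < α) (ℓ : ℝ) (hℓ : 0 < ℓ) (L T : ℕ)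
    (hL : 3 ≤ L) (hn : 1 ≤ ceilN L)
    (hyp : ∀ ζ ∈ stateSpace (box L) 0 (Set.Icc 0 (ceilN L)),
          α ≤ lawProb (glauberMod β L) T ζ (Gabs β L ℓ)) (f : Config → ℝ) :
    α ^ 2 * gVar β (box L) 0 (Set.Icc 0 (ceilN L)) (fieldF β L (box L)) f ≤
      ((2 * α + 4) * (T : ℝ) ^ 2 + 64 * ((L : ℝ) ^ 4 * Real.exp (8 * β * (L * ℓ)))) *
        dirichlet β (box L) 0 (Set.Icc 0 (ceilN L)) (fieldF β L (box L)) f ∧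
    (0 ≤ dirichlet β (box L) 0 (Set.Icc 0 (ceilN L)) (fieldF β L (box L)) f) ∧
    ((¬ ∀ η ∈ stateSpace (box L) 0 (Set.Icc 0 (ceilN L)),
      ∀ η' ∈ stateSpace (box L) 0 (Set.Icc 0 (ceilN L)), f η = f η') →
      0 < gVar β (box L) 0 (Set.Icc 0 (ceilN L)) (fieldF β L (box L)) f) ∧
    α * (L - L * ℓ) ≤ Real.exp (4 * β) * (L * ℓ + 1) := by
  set n := ceilN L with hnd
  set F := fieldF β L (box L) with hF
  set S := Om (box L) 0 n with hS
  set w := gWeight β (box L) 0 (Set.Icc 0 n) F with hw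
  set p := glauber β (box L) 0 (Set.Icc 0 n) F with hp
  have hbox : (box L).Nonempty := ⟨(1, 1), by rw [mem_box]; simp only; omega⟩
  have hch : ChainHyp S w p := glauber_chain β (box L) 0 n F hbox
  have hyp' : ∀ η ∈ S, α ≤ lawProb p T η (Gabs β L ℓ) := by
    intro η hη
    exact hyp η ((mem_Om _ _ _ _).1 hη)
  have hSne : S.Nonempty := by
    refine ⟨0, (mem_Om _ _ _ _).2 ⟨fun x _ => ?_, fun x _ => rfl⟩⟩
    simp only [Pi.zero_apply, Set.mem_Icc]; omega
  set Z := ∑ η ∈ S, w η with hZd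
  have hZ : 0 < Z := Finset.sum_pos hch.hw hSne
  set E := enA S w p f with hE
  have hE0 : 0 ≤ E := Finset.sum_nonneg fun η hη => Finset.sum_nonneg fun σ _ =>
    mul_nonneg (mul_nonneg (hch.hw η hη).le (hch.hp0 η hη σ)) (sq_nonneg _)
  have hZt : ∑' g : {x // x ∈ box L} → ℤ, w (extendC (box L) 0 g) = Z :=
    tsum_extend (box L) 0 n w (fun η h => gWeight_zero β (box L) 0 n F η h)
  have hexp : ∀ g : Config → ℝ, gExp β (box L) 0 (Set.Icc 0 n) F g = (∑ η ∈ S, w η * g η) / Z := by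
    intro g
    unfold gExp
    rw [← hw, hZt, tsum_extend (box L) 0 n (fun η => w η * g η)]
    intro η h
    rw [hw, gWeight_zero β (box L) 0 n F η h, zero_mul]
  have hD : dirichlet β (box L) 0 (Set.Icc 0 n) F f = E / (2 * Z) := by
    unfold dirichlet
    rw [hexp, hE, enA_eq hch f]
    have : ∀ η ∈ S, applyK (glauber β (box L) 0 (Set.Icc 0 n) F) f η = ∑ σ ∈ S, p η σ * f σ := by
      intro η hη
      unfold applyK
      exact tsum_eq_sum (fun σ hσ => by rw [← hp, hch.hpS η hη σ hσ, zero_mul])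
    rw [Finset.sum_congr rfl (fun η hη => by rw [this η hη])]
    field_simp
  set m := (∑ η ∈ S, w η * f η) / Z with hm
  have hV : gVar β (box L) 0 (Set.Icc 0 n) F f = (∑ η ∈ S, w η * (f η - m) ^ 2) / Z := by
    unfold gVar
    rw [hexp, hexp]
  have hmZ : ∑ η ∈ S, w η * f η = m * Z := by rw [hm]; field_simp
  have hV2 : ∑ y ∈ S, w y * ∑ x ∈ S, w x * (f x - f y) ^ 2
      = 2 * Z ^ 2 * gVar β (box L) 0 (Set.Icc 0 n) F f := by
    have e1 : ∀ c, ∑ x ∈ S, w x * (f x - c) ^ 2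
        = ∑ x ∈ S, w x * (f x - m) ^ 2 + Z * (m - c) ^ 2 := by
      intro c
      have : ∑ x ∈ S, w x * (f x - c) ^ 2 = ∑ x ∈ S, (w x * (f x - m) ^ 2
          + 2 * (m - c) * (w x * f x) + ((m - c) ^ 2 - 2 * (m - c) * m) * w x) :=
        Finset.sum_congr rfl fun x _ => by ring
      rw [this, Finset.sum_add_distrib, Finset.sum_add_distrib, ← Finset.mul_sum,
        ← Finset.mul_sum, hmZ]
      ring
    rw [Finset.sum_congr rfl (fun y _ => by rw [e1 (f y)])]
    simp_rw [mul_add]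
    rw [Finset.sum_add_distrib, ← Finset.sum_mul, hV]
    have e2 : ∑ y ∈ S, w y * (Z * (m - f y) ^ 2) = Z * ∑ y ∈ S, w y * (f y - m) ^ 2 := by
      rw [Finset.mul_sum]
      exact Finset.sum_congr rfl fun y _ => by ring
    rw [e2, ← hZd]
    field_simp
    ring
  set G := S.filter (fun σ => σ ∈ Gabs β L ℓ) with hG
  set M := Real.exp (8 * β * (L * ℓ)) with hM
  have hM0 : 0 < M := Real.exp_pos _
  have hgv := good_var β (box L) 0 n F (rKey L) (rKey_inj L) ((L + 1) * (2 * L))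
    (rKey_lt L) G (Finset.filter_subset _ _) M hM0.le w hw (by
      intro k a ha b hb
      rw [hG, Finset.mem_filter] at ha hb
      exact weight_mix β hβ L n ℓ hℓ a b ha.2 hb.2 ha.1 hb.1 k) f
  have hsD := sum_Dx β (box L) 0 n F hbox f
  rw [← hw, ← hp, ← hS, ← hE] at hsD
  rw [← hS, ← hZd, hsD] at hgv
  have hcard : ((box L).card : ℝ) = (L : ℝ) ^ 2 := by
    have : (box L).card = L ^ 2 := by
      unfold box
      rw [← Finset.Icc_product_Icc, Finset.card_product]
      simp [sq]
    rw [this]; push_cast; ring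
  rw [hcard] at hgv
  have htp := two_point hch T (Gabs β L ℓ) α hα hyp' f
  rw [hV2, ← hZd, ← hG] at htp
  have hAT := enA_le hch f T
  rw [← hE] at hAT
  have hLr : (3 : ℝ) ≤ L := by exact_mod_cast hL
  have hmain : α ^ 2 * (2 * Z ^ 2 * gVar β (box L) 0 (Set.Icc 0 n) F f) ≤
      ((2 * α + 4) * (T : ℝ) ^ 2 + 64 * ((L : ℝ) ^ 4 * M)) * (Z * E) := by
    have a1 : (2 * α + 4) * Z * enA S w (chainLaw p T) f ≤ (2 * α + 4) * Z * ((T : ℝ) ^ 2 * E) :=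
      mul_le_mul_of_nonneg_left hAT (mul_nonneg (add_nonneg (mul_nonneg two_pos.le hα.le) four_pos.le) hZ.le)
    have a2 : 4 * (((L + 1) * (2 * L) : ℕ) : ℝ) * M * Z * ((L : ℝ) ^ 2 * E) ≤
        16 * ((L : ℝ) ^ 4 * M) * (Z * E) := by
      exact alg_aux L hLr M Z E hM0.le hZ.le hE0
    linarith
  have hDE : E = 2 * Z * dirichlet β (box L) 0 (Set.Icc 0 n) F f := by
    rw [hD]; field_simp
  refine ⟨?_, ?_, ?_, ?_⟩
  · have : (2 * Z ^ 2) * (α ^ 2 * gVar β (box L) 0 (Set.Icc 0 n) F f) ≤ (2 * Z ^ 2) *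
        (((2 * α + 4) * (T : ℝ) ^ 2 + 64 * ((L : ℝ) ^ 4 * M)) *
          dirichlet β (box L) 0 (Set.Icc 0 n) F f) := by
      rw [hDE] at hmain
      linarith
    exact le_of_mul_le_mul_left this (mul_pos two_pos (pow_pos hZ 2))
  · rw [hD]; exact div_nonneg hE0 (mul_nonneg two_pos.le hZ.le)
  · intro hne
    rw [hV]
    apply div_pos _ hZ
    have hnn : ∀ η ∈ S, 0 ≤ w η * (f η - m) ^ 2 :=
      fun η hη => mul_nonneg (hch.hw η hη).le (sq_nonneg _)
    rcases (Finset.sum_nonneg hnn).lt_or_eq with h | h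
    · exact h
    · exfalso
      apply hne
      have h0 := (Finset.sum_eq_zero_iff_of_nonneg hnn).1 h.symm
      have h1 : ∀ η ∈ S, f η = m := by
        intro η hη
        have := h0 η hη
        rcases mul_eq_zero.1 this with h | h
        · exact absurd h (hch.hw η hη).ne'
        · have := pow_eq_zero_iff (two_ne_zero) |>.1 h
          linarith
      intro η hη η' hη'
      rw [h1 η ((mem_Om _ _ _ _).2 hη), h1 η' ((mem_Om _ _ _ _).2 hη')]
  · exact ell_lower β hβ L hn (by omega) ℓ α hℓ hα w hw S hS hZ
      (good_mass hch T (Gabs β L ℓ) α hyp')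

lemma ceilN_small (L : ℕ) (hL : L < 3) : ceilN L = 0 := by
  unfold ceilN
  rw [Int.floor_eq_zero_iff]
  interval_cases L
  · simp
  · simp
  · constructor
    · exact Real.log_nonneg (by norm_num)
    · have := Real.log_two_lt_d9
      push_cast
      linarith

lemma ceilN_big (L : ℕ) (hL : 3 ≤ L) : 1 ≤ ceilN L := by
  unfold ceilN
  rw [Int.le_floor]
  have hLr : (3 : ℝ) ≤ L := by exact_mod_cast hL
  rw [Int.cast_one, Real.le_log_iff_exp_le (by linarith)]
  have := Real.exp_one_lt_d9
  linarith

lemma poly_exp (β α s : ℝ) (hβ : 0 < β) (hα : 0 < α) (L : ℝ) (hL : 0 ≤ L)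
    (h : α * (L - s) ≤ Real.exp (4 * β) * (s + 1)) :
    L ^ 4 * Real.exp (8 * β * s) ≤
      (24 * Real.exp (7 * β) / (7 * β * (α / (α + Real.exp (4 * β)))) ^ 4) *
        Real.exp (15 * β * s) := by
  set e4 := Real.exp (4 * β) with he
  have he0 : 0 < e4 := Real.exp_pos _
  set c1 := α / (α + e4) with hc1
  have hc10 : 0 < c1 := by positivity
  have h1 : c1 * L ≤ s + 1 := by
    rw [hc1, div_mul_eq_mul_div, div_le_iff₀ (by positivity)]
    nlinarith
  set q := 7 * β * c1 with hq
  have hq0 : 0 < q := by positivity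
  have h2 : (q * L) ^ 4 / 24 ≤ Real.exp (q * L) := by
    have := Real.pow_div_factorial_le_exp (q * L) (by positivity) 4
    simpa [Nat.factorial] using this
  have h3 : Real.exp (q * L) ≤ Real.exp (7 * β) * Real.exp (7 * β * s) := by
    rw [← Real.exp_add]
    apply Real.exp_le_exp.2
    have := mul_le_mul_of_nonneg_left h1 (show 0 ≤ 7 * β by positivity)
    rw [hq]; linarith
  have h4 : L ^ 4 ≤ 24 * Real.exp (7 * β) / q ^ 4 * Real.exp (7 * β * s) := by
    rw [div_mul_eq_mul_div, le_div_iff₀ (by positivity)]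
    nlinarith
  calc L ^ 4 * Real.exp (8 * β * s)
      ≤ (24 * Real.exp (7 * β) / q ^ 4 * Real.exp (7 * β * s)) * Real.exp (8 * β * s) :=
        mul_le_mul_of_nonneg_right h4 (Real.exp_pos _).le
    _ = _ := by
        rw [mul_assoc, ← Real.exp_add]
        congr 2; ring

end Final

/-- Proposition 5.8 of the paper. Let `α, ℓ > 0` and `T` be such
that the Glauber dynamics for the modified SOS measure `π_{Λ_L}^{0,f}` satisfies
`P(η^ζ(T) ∈ G_ℓ) ≥ α` for every initial configuration `ζ`. Then there is a constant
`c = c(α,β)` such that `T_rel(L) ≤ c (exp(15βℓL) + L^{5β} T²)`. -/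
theorem sos_relaxation_from_good_set :
    ∀ β : ℝ, 0 < β → ∀ α : ℝ, 0 < α → ∃ c : ℝ, 0 < c ∧
      ∀ ℓ : ℝ, 0 < ℓ → ∀ L : ℕ, ∀ T : ℕ,
        (∀ ζ ∈ stateSpace (box L) 0 (Set.Icc 0 (ceilN L)),
          α ≤ lawProb (glauberMod β L) T ζ (Gabs β L ℓ)) →
        relaxTime β (box L) 0 (Set.Icc 0 (ceilN L)) (fieldF β L (box L)) ≤
          c * (Real.exp (15 * β * ℓ * L) + (L : ℝ) ^ (5 * β) * (T : ℝ) ^ 2) := by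
  intro β hβ α hα
  set C3 := 24 * Real.exp (7 * β) / (7 * β * (α / (α + Real.exp (4 * β)))) ^ 4 with hC3
  have hC30 : 0 < C3 := by positivity
  refine ⟨((2 * α + 4) + 64 * C3) / α ^ 2, by positivity, ?_⟩
  intro ℓ hℓ L T hyp
  have hrhs : 0 ≤ ((2 * α + 4) + 64 * C3) / α ^ 2 *
      (Real.exp (15 * β * ℓ * L) + (L : ℝ) ^ (5 * β) * (T : ℝ) ^ 2) := by positivity
  unfold relaxTime spectralGap
  rcases isEmpty_or_nonempty {f : Config → ℝ //
      ¬ ∀ η ∈ stateSpace (box L) 0 (Set.Icc 0 (ceilN L)),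
        ∀ η' ∈ stateSpace (box L) 0 (Set.Icc 0 (ceilN L)), f η = f η'} with hemp | hne
  · rw [Real.iInf_of_isEmpty, inv_zero]
    exact hrhs
  have hL : 3 ≤ L := by
    by_contra hlt
    obtain ⟨f, hf⟩ := hne
    apply hf
    rw [ceilN_small L (by omega)]
    intro η hη η' hη'
    have : η = η' := by
      funext x
      by_cases hx : x ∈ box L
      · have h1 := hη.1 x hx
        have h2 := hη'.1 x hx
        simp only [Set.Icc_self, Set.mem_singleton_iff] at h1 h2
        rw [h1, h2]
      · rw [hη.2 x hx, hη'.2 x hx]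
    rw [this]
  have hn := ceilN_big L hL
  have hLr : (3 : ℝ) ≤ L := by exact_mod_cast hL
  have core := poincare_core β hβ α hα ℓ hℓ L T hL hn hyp
  set B := (2 * α + 4) * (T : ℝ) ^ 2 + 64 * ((L : ℝ) ^ 4 * Real.exp (8 * β * (L * ℓ))) with hB
  have hB0 : 0 < B := by positivity
  have hgap : α ^ 2 / B ≤ ⨅ f : {f : Config → ℝ //
      ¬ ∀ η ∈ stateSpace (box L) 0 (Set.Icc 0 (ceilN L)),
        ∀ η' ∈ stateSpace (box L) 0 (Set.Icc 0 (ceilN L)), f η = f η'},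
      dirichlet β (box L) 0 (Set.Icc 0 (ceilN L)) (fieldF β L (box L)) f.1 /
        gVar β (box L) 0 (Set.Icc 0 (ceilN L)) (fieldF β L (box L)) f.1 := by
    apply le_ciInf
    rintro ⟨f, hf⟩
    obtain ⟨h1, h2, h3, _⟩ := core f
    have h4 := h3 hf
    rw [div_le_div_iff₀ hB0 h4]
    linarith
  have hpos : 0 < α ^ 2 / B := by positivity
  have hs := (core (fun _ => 0)).2.2.2
  have hpe := poly_exp β α (L * ℓ) hβ hα L (by positivity) hs
  rw [← hC3] at hpe
  calc _ ≤ (α ^ 2 / B)⁻¹ := inv_anti₀ hpos hgap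
    _ = B / α ^ 2 := inv_div _ _
    _ ≤ _ := by
      rw [div_mul_eq_mul_div]
      apply div_le_div_of_nonneg_right _ (by positivity)
      have e : 15 * β * (L * ℓ) = 15 * β * ℓ * L := by ring
      rw [e] at hpe
      set X := Real.exp (15 * β * ℓ * L) with hX
      have hX0 : 0 < X := Real.exp_pos _
      have hone : (1 : ℝ) ≤ (L : ℝ) ^ (5 * β) := Real.one_le_rpow (by linarith) (by positivity)
      have hT : (T : ℝ) ^ 2 ≤ (L : ℝ) ^ (5 * β) * (T : ℝ) ^ 2 := by
        have := mul_le_mul_of_nonneg_right hone (sq_nonneg (T : ℝ))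
        linarith
      set Y := (L : ℝ) ^ (5 * β) * (T : ℝ) ^ 2 with hY
      have hY0 : 0 ≤ Y := by positivity
      have k1 : (2 * α + 4) * (T : ℝ) ^ 2 ≤ (2 * α + 4) * Y :=
        mul_le_mul_of_nonneg_left hT (by positivity)
      have k2 : 0 ≤ (2 * α + 4) * X := by positivity
      have k3 : 0 ≤ 64 * C3 * Y := by positivity
      rw [hB]
      linarith

end SOSPaper
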